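/- Suppose condition (HP1) holds. Then every stable weak solution u of −Δ_p u = V|u|^{σ−1}u on ℝ^m vanishes identically, i.e. u = 0 almost everywhere on ℝ^m. -/

import Mathlib

open MeasureTheory Real Set Metric Filter
open scoped ENNReal NNReal RealInnerProductSpace

noncomputable section

/-- Euclidean space `ℝ^m`. -/
abbrev Em (m : ℕ) := EuclideanSpace ℝ (Fin m)

/-- A Lipschitz function with compact support. -/
def LipCS {m : ℕ} (φ : Em m → ℝ) : Prop :=
  (∃ L : ℝ≥0, LipschitzWith L φ) ∧ HasCompactSupport φ

/-- `u` is a weak solution of `-Δ_p u = V |u|^(σ-1) u` on `ℝ^m`: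
`u` is `C¹`, `|∇u|^p` and `V |u|^(σ+1)` are locally integrable, and the weak
formulation holds against every Lipschitz test function with compact support. -/
def IsWeakSol {m : ℕ} (p σ : ℝ) (V u : Em m → ℝ) : Prop :=
  ContDiff ℝ 1 u ∧
  LocallyIntegrable (fun x => ‖gradient u x‖ ^ p) volume ∧
  LocallyIntegrable (fun x => V x * |u x| ^ (σ + 1)) volume ∧
  ∀ φ : Em m → ℝ, LipCS φ →
    (∫ x, ‖gradient u x‖ ^ (p - 2) * ⟪gradient u x, gradient φ x⟫) =
      ∫ x, V x * |u x| ^ (σ - 1) * u x * φ x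

/-- Stability of a weak solution `u`. -/
def IsStable {m : ℕ} (p σ : ℝ) (V u : Em m → ℝ) : Prop :=
  ∀ φ : Em m → ℝ, LipCS φ →
    σ * ∫ x, V x * |u x| ^ (σ - 1) * φ x ^ 2 ≤
      (∫ x, ‖gradient u x‖ ^ (p - 2) * ‖gradient φ x‖ ^ 2) +
        (p - 2) * ∫ x, ‖gradient u x‖ ^ (p - 4) * ⟪gradient u x, gradient φ x⟫ ^ 2

/-- `γ̄ = (2σ - p + 1 + 2√(σ(σ - p + 1)))/(p - 1)`. -/
def gammaBar (p σ : ℝ) : ℝ := (2 * σ - p + 1 + 2 * Real.sqrt (σ * (σ - p + 1))) / (p - 1)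

/-- `α = p (σ + γ̄)/(σ - p + 1)`. -/
def alphaC (p σ : ℝ) : ℝ := p * (σ + gammaBar p σ) / (σ - p + 1)

/-- `β = (γ̄ + p - 1)/(σ - p + 1)`. -/
def betaC (p σ : ℝ) : ℝ := (gammaBar p σ + p - 1) / (σ - p + 1)

/-- The critical exponent `σ_c(m, p)`. -/
def sigmaC (mr p : ℝ) : ℝ :=
  (((p - 1) * mr - p) ^ 2 + p ^ 2 * (p - 2) - p ^ 2 * (p - 1) * mr +
      2 * p ^ 2 * Real.sqrt ((p - 1) * (mr - 1))) /
    ((mr - p) * ((p - 1) * mr - p * (p + 3)))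

/-- Condition (HP1). -/
def HP1 {m : ℕ} (p σ : ℝ) (V : Em m → ℝ) : Prop :=
  ∃ C C₀ R₀ ε₀ : ℝ, 0 < C ∧ 0 < C₀ ∧ 0 < R₀ ∧ 0 < ε₀ ∧
    ∀ ε ∈ Set.Ioo (0 : ℝ) ε₀, ∀ R > R₀,
      (∫⁻ x in Metric.ball (0 : Em m) R \ Metric.ball (0 : Em m) (R / 2),
          ENNReal.ofReal (V x ^ (-(betaC p σ) + ε))) ≤
        ENNReal.ofReal (C * R ^ (alphaC p σ + C₀ * ε) * (Real.log R)⁻¹)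

/-- Condition (HP2). -/
def HP2 {m : ℕ} (p σ : ℝ) (V : Em m → ℝ) : Prop :=
  ∃ C C₀ R₀ ε₀ θ b : ℝ, 0 < C ∧ 0 < C₀ ∧ 0 < R₀ ∧ 0 < ε₀ ∧ 0 < θ ∧
    b < -1 + θ / (σ - p + 1) ∧
    ∀ ε ∈ Set.Ioo (0 : ℝ) ε₀, ∀ R > R₀,
      (∫⁻ x in Metric.ball (0 : Em m) R \ Metric.ball (0 : Em m) (R / 2),
          ENNReal.ofReal (V x ^ (-(betaC p σ) + ε))) ≤
        ENNReal.ofReal (C * R ^ (alphaC p σ + C₀ * ε) * Real.log R ^ b *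
          Real.exp (-θ * ε * Real.log (R / 2) * Real.log (Real.log (R / 2))))

/-! ### Powers with sign and the gradients of the test functions -/

theorem hasDerivAt_abs_rpow_mul_self {r : ℝ} (hr : 0 < r) (s : ℝ) :
    HasDerivAt (fun y : ℝ => |y| ^ r * y) ((r + 1) * |s| ^ r) s := by
  rcases eq_or_ne s 0 with rfl | hs
  · rw [abs_zero, Real.zero_rpow hr.ne', mul_zero, hasDerivAt_iff_isLittleO_nhds_zero]
    simp only [zero_add, mul_zero, sub_zero, smul_zero]
    have h0 : Tendsto (fun y : ℝ => |y| ^ r) (nhds 0) (nhds 0) := by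
      have hc : Continuous fun y : ℝ => |y| ^ r :=
        continuous_abs.rpow_const fun _ => Or.inr hr.le
      simpa [Real.zero_rpow hr.ne'] using hc.tendsto 0
    have := (Asymptotics.isLittleO_one_iff ℝ).2 h0
    simpa using this.mul_isBigO (Asymptotics.isBigO_refl (fun y : ℝ => y) (nhds 0))
  · have habs : 0 < |s| := abs_pos.2 hs
    have h1 := ((hasDerivAt_abs hs).rpow_const (p := r) (Or.inl habs.ne')).mul (hasDerivAt_id s)
    have h2 : (SignType.sign s : ℝ) * s = |s| := sign_mul_self s
    refine h1.congr_deriv ?_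
    have h3 : |s| ^ (r - 1) * |s| = |s| ^ r := by
      rw [← Real.rpow_add_one habs.ne', sub_add_cancel]
    simp only [id_eq, mul_one]
    calc (SignType.sign s : ℝ) * r * |s| ^ (r - 1) * s + |s| ^ r
        = r * (|s| ^ (r - 1) * ((SignType.sign s : ℝ) * s)) + |s| ^ r := by ring
      _ = (r + 1) * |s| ^ r := by rw [h2, h3]; ring

theorem contDiff_abs_rpow_mul_self {r : ℝ} (hr : 0 < r) :
    ContDiff ℝ 1 (fun y : ℝ => |y| ^ r * y) := by
  rw [contDiff_one_iff_deriv]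
  refine ⟨fun s => (hasDerivAt_abs_rpow_mul_self hr s).differentiableAt, ?_⟩
  rw [funext fun s => (hasDerivAt_abs_rpow_mul_self hr s).deriv]
  exact continuous_const.mul (continuous_abs.rpow_const fun _ => Or.inr hr.le)

section TestFunctions

variable {m : ℕ} {u η : Em m → ℝ}

theorem continuous_gradient (hu : ContDiff ℝ 1 u) : Continuous (gradient u) :=
  (InnerProductSpace.toDual ℝ (Em m)).symm.continuous.comp (hu.continuous_fderiv one_ne_zero)

theorem gradient_abs_rpow_mul_self_mul_pow (hu : ContDiff ℝ 1 u) (hη : ContDiff ℝ 1 η) {r : ℝ}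
    (hr : 0 < r) (k : ℕ) (x : Em m) :
    gradient (fun y => |u y| ^ r * u y * η y ^ (k + 1)) x =
      ((r + 1) * |u x| ^ r * η x ^ (k + 1)) • gradient u x +
        (|u x| ^ r * u x * ((k + 1) * η x ^ k)) • gradient η x := by
  have hu' := (hu.differentiable one_ne_zero x).hasFDerivAt
  have hη' := (hη.differentiable one_ne_zero x).hasFDerivAt
  have h1 := (hasDerivAt_abs_rpow_mul_self hr (u x)).comp_hasFDerivAt x hu'
  have h2 := (hasDerivAt_pow (k + 1) (η x)).comp_hasFDerivAt x hη'
  have h3 := h1.mul h2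
  have h4 : fderiv ℝ (fun y => |u y| ^ r * u y * η y ^ (k + 1)) x = _ := h3.fderiv
  simp only [gradient, h4, map_add, map_smul, smul_smul, Function.comp]
  rw [add_comm]
  congr 2
  · ring
  · push_cast
    simp

theorem lipCS_abs_rpow_mul_self_mul_pow (hu : ContDiff ℝ 1 u) (hη : ContDiff ℝ 1 η)
    (hc : HasCompactSupport η) {r : ℝ} (hr : 0 < r) (k : ℕ) :
    LipCS (fun y => |u y| ^ r * u y * η y ^ (k + 1)) := by
  have hs : HasCompactSupport (fun y => |u y| ^ r * u y * η y ^ (k + 1)) := by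
    refine hc.mono fun x hx => ?_
    rw [Function.mem_support] at hx ⊢
    intro h
    exact hx (by simp [h])
  refine ⟨ContDiff.lipschitzWith_of_hasCompactSupport (𝕂 := ℝ) hs (n := 1) ?_ one_ne_zero, hs⟩
  exact ((contDiff_abs_rpow_mul_self hr).comp hu).mul (hη.pow _)

end TestFunctions

/-! ### Pointwise identities and Young-type inequalities -/

section Pointwise

variable {E : Type*} [NormedAddCommGroup E] [InnerProductSpace ℝ E]

theorem rpow_sub_two_mul_sq {a p : ℝ} (ha : 0 ≤ a) (hp : 2 ≤ p) :
    a ^ (p - 2) * a ^ 2 = a ^ p := by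
  rw [← Real.rpow_natCast a 2, ← Real.rpow_add_of_nonneg ha (by linarith) (by norm_num)]
  norm_num

theorem norm_rpow_mul_inner_test {p γ t h : ℝ} (hp : 2 ≤ p) (k : ℕ) (G H : E) :
    ‖G‖ ^ (p - 2) * ⟪G, (γ * |t| ^ (γ - 1) * h ^ (2 * k + 1 + 1)) • G +
        (|t| ^ (γ - 1) * t * (((2 * k + 1 : ℕ) + 1) * h ^ (2 * k + 1))) • H⟫ =
      γ * (‖G‖ ^ p * |t| ^ (γ - 1) * h ^ (2 * k + 2)) +
        (2 * k + 2) * (‖G‖ ^ (p - 2) * ⟪G, H⟫ * (|t| ^ (γ - 1) * t * h ^ (2 * k + 1))) := by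
  rw [inner_add_right, real_inner_smul_right, real_inner_smul_right, real_inner_self_eq_norm_sq,
    ← rpow_sub_two_mul_sq (norm_nonneg G) hp]
  push_cast
  ring

theorem abs_rpow_half_sq {t γ : ℝ} : (|t| ^ ((γ - 1) / 2)) ^ 2 = |t| ^ (γ - 1) := by
  rw [← Real.rpow_natCast, ← Real.rpow_mul (abs_nonneg t)]
  norm_num

theorem abs_rpow_sub_one_mul_sq {t γ : ℝ} (hγ : 1 < γ) :
    |t| ^ (γ - 1) * t ^ 2 = |t| ^ (γ + 1) := by
  rw [← sq_abs, ← Real.rpow_natCast |t| 2,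
    ← Real.rpow_add_of_nonneg (abs_nonneg t) (by linarith) (by norm_num)]
  norm_num
  ring_nf

/-- The density of the quadratic form of the stability condition for the test function
`|u|^((γ-1)/2) u η^(k+1)`, isotropic part. -/
theorem norm_rpow_mul_norm_sq_test {p γ t h : ℝ} (hp : 2 ≤ p) (hγ : 1 < γ) (k : ℕ) (G H : E) :
    ‖G‖ ^ (p - 2) * ‖(((γ - 1) / 2 + 1) * |t| ^ ((γ - 1) / 2) * h ^ (k + 1)) • G +
        (|t| ^ ((γ - 1) / 2) * t * ((k + 1) * h ^ k)) • H‖ ^ 2 =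
      (γ + 1) ^ 2 / 4 * (‖G‖ ^ p * |t| ^ (γ - 1) * h ^ (2 * k + 2)) +
        (k + 1) * (γ + 1) *
          (‖G‖ ^ (p - 2) * ⟪G, H⟫ * (|t| ^ (γ - 1) * t * h ^ (2 * k + 1))) +
        (k + 1) ^ 2 * (‖G‖ ^ (p - 2) * ‖H‖ ^ 2 * (|t| ^ (γ + 1) * h ^ (2 * k))) := by
  rw [norm_add_sq_real, norm_smul, norm_smul, real_inner_smul_left, real_inner_smul_right,
    mul_pow, mul_pow, Real.norm_eq_abs, Real.norm_eq_abs, sq_abs, sq_abs,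
    ← abs_rpow_sub_one_mul_sq hγ, ← rpow_sub_two_mul_sq (norm_nonneg G) hp,
    ← abs_rpow_half_sq (t := t) (γ := γ)]
  ring

/-- The density of the quadratic form of the stability condition for the test function
`|u|^((γ-1)/2) u η^(k+1)`, anisotropic part. -/
theorem norm_rpow_mul_inner_sq_test {p γ t h : ℝ} (hp : 2 ≤ p) (hγ : 1 < γ) (hh : 0 ≤ h) (k : ℕ)
    (G H : E) :
    ‖G‖ ^ (p - 4) * ⟪G, (((γ - 1) / 2 + 1) * |t| ^ ((γ - 1) / 2) * h ^ (k + 1)) • G +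
        (|t| ^ ((γ - 1) / 2) * t * ((k + 1) * h ^ k)) • H⟫ ^ 2 ≤
      (γ + 1) ^ 2 / 4 * (‖G‖ ^ p * |t| ^ (γ - 1) * h ^ (2 * k + 2)) +
        (k + 1) * (γ + 1) *
          (‖G‖ ^ (p - 2) * ⟪G, H⟫ * (|t| ^ (γ - 1) * t * h ^ (2 * k + 1))) +
        (k + 1) ^ 2 * (‖G‖ ^ (p - 2) * ‖H‖ ^ 2 * (|t| ^ (γ + 1) * h ^ (2 * k))) := by
  rcases eq_or_ne G 0 with rfl | hG
  · simp only [inner_zero_left, norm_zero]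
    have h1 : (0 : ℝ) ^ p = 0 := Real.zero_rpow (by linarith)
    have h2 : (0 : ℝ) ≤ 0 ^ (p - 2) := Real.rpow_nonneg le_rfl _
    rw [h1]
    have : 0 ≤ ((k : ℝ) + 1) ^ 2 * (0 ^ (p - 2) * ‖H‖ ^ 2 * (|t| ^ (γ + 1) * h ^ (2 * k))) := by
      positivity
    simpa using this
  · have hpos : 0 < ‖G‖ := norm_pos_iff.2 hG
    have hcs : ⟪G, H⟫ ^ 2 ≤ ‖G‖ ^ 2 * ‖H‖ ^ 2 := by
      rw [← mul_pow, ← sq_abs]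
      exact pow_le_pow_left₀ (abs_nonneg _) (abs_real_inner_le_norm G H) 2
    have h2 : ‖G‖ ^ (p - 2) = ‖G‖ ^ (p - 4) * ‖G‖ ^ 2 := by
      rw [← Real.rpow_natCast ‖G‖ 2, ← Real.rpow_add hpos]
      norm_num
      ring_nf
    have h4 : 0 ≤ ‖G‖ ^ (p - 4) := Real.rpow_nonneg hpos.le _
    rw [inner_add_right, real_inner_smul_right, real_inner_smul_right, real_inner_self_eq_norm_sq,
      ← abs_rpow_sub_one_mul_sq hγ, ← rpow_sub_two_mul_sq (norm_nonneg G) hp, h2,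
      ← abs_rpow_half_sq (t := t) (γ := γ)]
    have h5 : 0 ≤ ((|t| ^ ((γ - 1) / 2)) ^ 2 * t ^ 2 * ((k + 1) ^ 2 * h ^ (2 * k)) *
        ‖G‖ ^ (p - 4)) * (‖G‖ ^ 2 * ‖H‖ ^ 2 - ⟪G, H⟫ ^ 2) :=
      mul_nonneg (by positivity) (by linarith)
    linear_combination h5

end Pointwise

theorem rpow_mul_pow_le_add {x y τ p : ℝ} (hx : 0 ≤ x) (hy : 0 ≤ y) (hτ : 0 < τ) (hτ1 : τ ≤ 1)
    (hp : 2 ≤ p) (j : ℕ) (hj : 1 ≤ j) (hj2 : j ≤ 2) :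
    x ^ (p - j) * y ^ j ≤ τ * x ^ p + τ ^ (-(p - 1)) * y ^ p := by
  have hjr : (1 : ℝ) ≤ j := by exact_mod_cast hj
  have hjr2 : (j : ℝ) ≤ 2 := by exact_mod_cast hj2
  have hsplit : ∀ z : ℝ, 0 ≤ z → z ^ (p - j) * z ^ j = z ^ p := fun z hz => by
    rw [← Real.rpow_natCast z j, ← Real.rpow_add_of_nonneg hz (by linarith) (by linarith)]
    ring_nf
  have hA : 0 ≤ τ * x ^ p := by positivity
  have hB : 0 ≤ τ ^ (-(p - 1)) * y ^ p := by positivity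
  rcases le_total y (τ * x) with h | h
  · have : x ^ (p - j) * y ^ j ≤ τ * x ^ p := by
      calc x ^ (p - j) * y ^ j ≤ x ^ (p - j) * (τ * x) ^ j := by gcongr
        _ = τ ^ j * (x ^ (p - j) * x ^ j) := by ring
        _ ≤ τ * (x ^ (p - j) * x ^ j) := by
          gcongr
          exact pow_le_of_le_one hτ.le hτ1 (by omega)
        _ = τ * x ^ p := by rw [hsplit x hx]
    linarith
  · have h' : x ≤ τ⁻¹ * y := by
      rw [inv_mul_eq_div, le_div_iff₀ hτ]
      linarith
    have : x ^ (p - j) * y ^ j ≤ τ ^ (-(p - 1)) * y ^ p := by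
      calc x ^ (p - j) * y ^ j ≤ (τ⁻¹ * y) ^ (p - j) * y ^ j := by
            gcongr
            linarith
        _ = τ⁻¹ ^ (p - j) * (y ^ (p - j) * y ^ j) := by
          rw [Real.mul_rpow (by positivity) hy]; ring
        _ ≤ τ⁻¹ ^ (p - 1) * (y ^ (p - j) * y ^ j) := by
          gcongr
          exact (one_le_inv₀ hτ).2 hτ1
        _ = τ ^ (-(p - 1)) * y ^ p := by
          rw [hsplit y hy, Real.inv_rpow hτ.le, Real.rpow_neg hτ.le]
    linarith

/-- Young's inequality for the first order and the zero order error terms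
(`j = 1` and `j = 2`, respectively). -/
theorem young_gradient_term {a b h g p γ τ : ℝ} (ha : 0 ≤ a) (hb : 0 ≤ b) (hh : 0 ≤ h)
    (hg : 0 ≤ g) (hp : 2 ≤ p) (hγ : 1 < γ) (k j i : ℕ) (hk : p ≤ 2 * k + 2)
    (hτ : 0 < τ) (hτ1 : τ ≤ 1) (hj : 1 ≤ j) (hj2 : j ≤ 2) (hij : i + j = 2 * k + 2) :
    a ^ (p - j) * g ^ j * (b ^ (γ - 1 + j) * h ^ i) ≤
      τ * (a ^ p * b ^ (γ - 1) * h ^ (2 * k + 2)) +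
        τ ^ (-(p - 1)) * (b ^ (γ + p - 1) * g ^ p * h ^ (2 * k + 2 - p)) := by
  have hjr : (1 : ℝ) ≤ j := by exact_mod_cast hj
  have hjr2 : (j : ℝ) ≤ 2 := by exact_mod_cast hj2
  have hijr : (i : ℝ) + j = 2 * k + 2 := by exact_mod_cast hij
  have hP : 0 ≤ b ^ (γ - 1) * h ^ (2 * k + 2 - p) := by positivity
  have key := mul_le_mul_of_nonneg_left
    (rpow_mul_pow_le_add (mul_nonneg ha hh) (mul_nonneg hb hg) hτ hτ1 hp j hj hj2) hP
  have e1 : h ^ (2 * k + 2 - p) * h ^ (p - j) = h ^ i := by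
    rw [← Real.rpow_add_of_nonneg hh (by linarith) (by linarith), ← Real.rpow_natCast h i]
    congr 1
    linarith
  have e2 : b ^ (γ - 1) * b ^ j = b ^ (γ - 1 + j) := by
    rw [← Real.rpow_natCast b j, ← Real.rpow_add_of_nonneg hb (by linarith) (by linarith)]
  have e3 : h ^ (2 * k + 2 - p) * h ^ p = h ^ (2 * k + 2) := by
    rw [← Real.rpow_add_of_nonneg hh (by linarith) (by linarith),
      ← Real.rpow_natCast h (2 * k + 2)]
    congr 1
    push_cast
    ring
  have e4 : b ^ (γ - 1) * b ^ p = b ^ (γ + p - 1) := by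
    rw [← Real.rpow_add_of_nonneg hb (by linarith) (by linarith)]
    congr 1
    ring
  rw [Real.mul_rpow ha hh, Real.mul_rpow ha hh, Real.mul_rpow hb hg, mul_pow] at key
  rw [← e1, ← e2, ← e3, ← e4]
  linarith

/-- Young's inequality absorbing the lower order term into `v b^(e+s) h^l`. -/
theorem young_potential_term {W b h v μ e s p l : ℝ} (hW : 0 ≤ W) (hb : 0 ≤ b) (hh : 0 ≤ h)
    (hh1 : h ≤ 1) (hv : 0 < v) (hμ : 0 < μ) (he : 0 < e) (hs : 0 < s) (hp : 0 < p)
    (hl : p * (1 + e / s) < l) :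
    W * (b ^ e * h ^ (l - p)) ≤
      μ * (v * b ^ (e + s) * h ^ l) + W ^ (1 + e / s) * (μ * v) ^ (-(e / s)) := by
  have hes : 0 < e / s := by positivity
  have hlp : 0 < l - p := by nlinarith [mul_pos hp hes]
  have hA : 0 ≤ μ * (v * b ^ (e + s) * h ^ l) := by positivity
  have hB : 0 ≤ W ^ (1 + e / s) * (μ * v) ^ (-(e / s)) := by positivity
  rcases hb.eq_or_lt with rfl | hb
  · rw [Real.zero_rpow he.ne']; simp only [zero_mul, mul_zero]; linarith
  rcases hh.eq_or_lt with rfl | hh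
  · rw [Real.zero_rpow hlp.ne', mul_zero, mul_zero]
    linarith
  have e1 : b ^ (e + s) * h ^ l = (b ^ e * h ^ (l - p)) * (b ^ s * h ^ p) := by
    rw [Real.rpow_add hb, show l = (l - p) + p by ring, Real.rpow_add hh]
    ring_nf
  have hQ : 0 ≤ b ^ e * h ^ (l - p) := by positivity
  have hμv : 0 < μ * v := by positivity
  rcases le_total W (μ * v * (b ^ s * h ^ p)) with hc | hc
  · have := mul_le_mul_of_nonneg_right hc hQ
    have e2 : μ * (v * b ^ (e + s) * h ^ l) =
        μ * v * (b ^ s * h ^ p) * (b ^ e * h ^ (l - p)) := by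
      linear_combination μ * v * e1
    linarith
  · have h1 : b ^ s * h ^ p ≤ W / (μ * v) := by
      rw [le_div_iff₀ hμv]; linarith
    have h2 : (b ^ s * h ^ p) ^ (e / s) ≤ (W / (μ * v)) ^ (e / s) :=
      Real.rpow_le_rpow (by positivity) h1 hes.le
    have h3 : (b ^ s * h ^ p) ^ (e / s) = b ^ e * h ^ (p * (e / s)) := by
      rw [Real.mul_rpow (by positivity) (by positivity), ← Real.rpow_mul hb.le,
        ← Real.rpow_mul hh.le, mul_div_cancel₀ _ hs.ne']
    have h4 : h ^ (l - p) ≤ h ^ (p * (e / s)) :=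
      Real.rpow_le_rpow_of_exponent_ge hh hh1 (by linarith)
    have h5 : W * (b ^ e * h ^ (l - p)) ≤ W ^ (1 + e / s) * (μ * v) ^ (-(e / s)) := by
      calc W * (b ^ e * h ^ (l - p)) ≤ W * (b ^ e * h ^ (p * (e / s))) := by gcongr
        _ ≤ W * (W / (μ * v)) ^ (e / s) := by rw [← h3]; gcongr
        _ = W ^ (1 + e / s) * (μ * v) ^ (-(e / s)) := by
          rw [Real.rpow_add_of_nonneg hW zero_le_one hes.le, Real.rpow_one,
            Real.div_rpow hW hμv.le, Real.rpow_neg hμv.le]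
          ring
    linarith

/-! ### The Caccioppoli-type inequality -/

section Caccioppoli

variable {m : ℕ} {u η V : Em m → ℝ}

theorem integrable_of_continuous_of_eq_zero {f : Em m → ℝ} (hf : Continuous f)
    (hc : HasCompactSupport η) (h0 : ∀ x, η x = 0 → gradient η x = 0 → f x = 0) :
    Integrable f := by
  refine hf.integrable_of_hasCompactSupport (HasCompactSupport.intro hc fun x hx => ?_)
  refine h0 x (image_eq_zero_of_notMem_tsupport hx) ?_
  have : fderiv ℝ η x = 0 :=
    image_eq_zero_of_notMem_tsupport fun h => hx (tsupport_fderiv_subset ℝ h)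
  simp [gradient, this]

theorem integrable_potential_mul (hV : LocallyIntegrable V volume) (hu : Continuous u)
    (hη : Continuous η) (hc : HasCompactSupport η) {r : ℝ} (hr : 0 ≤ r) {l : ℕ} (hl : l ≠ 0) :
    Integrable (fun x => V x * |u x| ^ r * η x ^ l) := by
  have h1 : Continuous fun x => |u x| ^ r * η x ^ l :=
    (hu.abs.rpow_const fun _ => Or.inr hr).mul (hη.pow l)
  have h2 : HasCompactSupport fun x => |u x| ^ r * η x ^ l :=
    HasCompactSupport.intro hc fun x hx => by
      simp [image_eq_zero_of_notMem_tsupport hx, hl]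
  simpa [smul_eq_mul, mul_assoc] using hV.integrable_smul_right_of_hasCompactSupport h1 h2

theorem abs_rpow_mul_abs_rpow_mul_sq {t σ γ : ℝ} (hσ : 1 < σ) (hγ : 1 < γ) :
    |t| ^ (σ - 1) * (|t| ^ (γ - 1) * t ^ 2) = |t| ^ (σ + γ) := by
  rw [abs_rpow_sub_one_mul_sq hγ,
    ← Real.rpow_add_of_nonneg (abs_nonneg t) (by linarith) (by linarith)]
  congr 1
  ring

theorem integral_potential_le_caccioppoli {p σ γ κ τ : ℝ} (hp : 2 ≤ p) (hσ : p - 1 < σ)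
    (hu : IsWeakSol p σ V u) (hst : IsStable p σ V u)
    (hη : ContDiff ℝ 1 η) (hc : HasCompactSupport η) (hη0 : ∀ x, 0 ≤ η x)
    (hγ : 1 < γ) (k : ℕ) (hk : p ≤ 2 * k + 2) (hκ : 0 < κ)
    (hκ' : (k + 1) * |(p - 1) * (γ + 1) - 2 * σ| + (p - 1) * (k + 1) ^ 2 ≤ κ)
    (hτ : 0 < τ) (hτ1 : τ ≤ 1) (hδ : 2 * κ * τ ≤ σ * γ - (p - 1) * (γ + 1) ^ 2 / 4) :
    ∫ x, V x * |u x| ^ (σ + γ) * η x ^ (2 * k + 2) ≤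
      (γ + 4 * (k + 1)) * τ ^ (-p) *
        ∫ x, |u x| ^ (γ + p - 1) * ‖gradient η x‖ ^ p * η x ^ (2 * k + 2 - p) := by
  obtain ⟨hu1, -, -, hweak⟩ := hu
  have hσ1 : 1 < σ := by linarith
  have hgu := continuous_gradient hu1
  have hgη := continuous_gradient hη
  have hcu := hu1.continuous
  have hcη := hη.continuous
  have hcupow : ∀ r : ℝ, 0 ≤ r → Continuous fun x => |u x| ^ r :=
    fun r hr => hcu.abs.rpow_const fun _ => Or.inr hr
  have hcgpow : ∀ r : ℝ, 0 ≤ r → Continuous fun x => ‖gradient u x‖ ^ r :=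
    fun r hr => hgu.norm.rpow_const fun _ => Or.inr hr
  obtain ⟨fA, hfA⟩ : ∃ f : Em m → ℝ, ∀ x, f x =
    ‖gradient u x‖ ^ p * |u x| ^ (γ - 1) * η x ^ (2 * k + 2) := ⟨_, fun _ => rfl⟩
  obtain ⟨fX, hfX⟩ : ∃ f : Em m → ℝ, ∀ x, f x =
    ‖gradient u x‖ ^ (p - 2) * ⟪gradient u x, gradient η x⟫ *
      (|u x| ^ (γ - 1) * u x * η x ^ (2 * k + 1)) := ⟨_, fun _ => rfl⟩
  obtain ⟨fY, hfY⟩ : ∃ f : Em m → ℝ, ∀ x, f x =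
    ‖gradient u x‖ ^ (p - 2) * ‖gradient η x‖ ^ 2 * (|u x| ^ (γ + 1) * η x ^ (2 * k)) :=
      ⟨_, fun _ => rfl⟩
  obtain ⟨fB, hfB⟩ : ∃ f : Em m → ℝ, ∀ x, f x =
    |u x| ^ (γ + p - 1) * ‖gradient η x‖ ^ p * η x ^ (2 * k + 2 - p) := ⟨_, fun _ => rfl⟩
  have iA : Integrable fA := by
    refine integrable_of_continuous_of_eq_zero ?_ hc fun x h1 h2 => by simp [hfA, h1]
    rw [funext hfA]
    exact ((hcgpow p (by linarith)).mul (hcupow _ (by linarith))).mul (hcη.pow _)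
  have iX : Integrable fX := by
    refine integrable_of_continuous_of_eq_zero ?_ hc fun x h1 h2 => by simp [hfX, h1]
    rw [funext hfX]
    exact ((hcgpow _ (by linarith)).mul (hgu.inner hgη)).mul
      (((hcupow _ (by linarith)).mul hcu).mul (hcη.pow _))
  have iY : Integrable fY := by
    refine integrable_of_continuous_of_eq_zero ?_ hc fun x h1 h2 => by simp [hfY, h2]
    rw [funext hfY]
    exact ((hcgpow _ (by linarith)).mul (hgη.norm.pow 2)).mul
      ((hcupow _ (by linarith)).mul (hcη.pow _))
  have iB : Integrable fB := by
    refine integrable_of_continuous_of_eq_zero ?_ hc fun x h1 h2 => by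
      simp [hfB, h2, Real.zero_rpow (show p ≠ 0 by linarith)]
    rw [funext hfB]
    exact ((hcupow _ (by linarith)).mul (hgη.norm.rpow_const fun _ => Or.inr (by linarith))).mul
      (hcη.rpow_const fun _ => Or.inr (by linarith))
  have hA0 : 0 ≤ ∫ x, fA x := integral_nonneg fun x => by
    rw [hfA]; have := hη0 x; positivity
  have hB0 : 0 ≤ ∫ x, fB x := integral_nonneg fun x => by
    rw [hfB]; have := hη0 x; positivity
  -- the equation tested with `|u|^(γ-1) u η^(2k+2)`
  have hW : γ * (∫ x, fA x) + (2 * k + 2) * ∫ x, fX x =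
      ∫ x, V x * |u x| ^ (σ + γ) * η x ^ (2 * k + 2) := by
    have h := hweak _ (lipCS_abs_rpow_mul_self_mul_pow hu1 hη hc (sub_pos.2 hγ) (2 * k + 1))
    rw [← integral_const_mul, ← integral_const_mul,
      ← integral_add (iA.const_mul _) (iX.const_mul _)]
    convert h using 1
    · refine integral_congr_ae (ae_of_all _ fun x => ?_)
      simp only []
      rw [gradient_abs_rpow_mul_self_mul_pow hu1 hη (sub_pos.2 hγ), sub_add_cancel,
        norm_rpow_mul_inner_test hp, hfA, hfX]
    · refine integral_congr_ae (ae_of_all _ fun x => ?_)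
      simp only []
      rw [← abs_rpow_mul_abs_rpow_mul_sq hσ1 hγ]
      ring
  -- the stability condition tested with `|u|^((γ-1)/2) u η^(k+1)`
  have hS : σ * (∫ x, V x * |u x| ^ (σ + γ) * η x ^ (2 * k + 2)) ≤
      (p - 1) * ((γ + 1) ^ 2 / 4 * (∫ x, fA x) + (k + 1) * (γ + 1) * (∫ x, fX x) +
        (k + 1) ^ 2 * ∫ x, fY x) := by
    have hr : 0 < (γ - 1) / 2 := by linarith
    have h := hst _ (lipCS_abs_rpow_mul_self_mul_pow hu1 hη hc hr k)
    have iAX : Integrable fun x => (γ + 1) ^ 2 / 4 * fA x + (k + 1) * (γ + 1) * fX x :=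
      (iA.const_mul _).add (iX.const_mul _)
    have iQ : Integrable fun x => (γ + 1) ^ 2 / 4 * fA x + (k + 1) * (γ + 1) * fX x +
        (k + 1) ^ 2 * fY x :=
      iAX.add (iY.const_mul _)
    have hQ : ∫ x, ((γ + 1) ^ 2 / 4 * fA x + (k + 1) * (γ + 1) * fX x + (k + 1) ^ 2 * fY x) =
        (γ + 1) ^ 2 / 4 * (∫ x, fA x) + (k + 1) * (γ + 1) * (∫ x, fX x) +
          (k + 1) ^ 2 * ∫ x, fY x := by
      rw [integral_add iAX (iY.const_mul _),
        integral_add (iA.const_mul _) (iX.const_mul _)]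
      simp only [integral_const_mul]
    rw [← hQ]
    have h1 : ∫ x, ‖gradient u x‖ ^ (p - 2) *
        ‖gradient (fun y => |u y| ^ ((γ - 1) / 2) * u y * η y ^ (k + 1)) x‖ ^ 2 =
        ∫ x, ((γ + 1) ^ 2 / 4 * fA x + (k + 1) * (γ + 1) * fX x + (k + 1) ^ 2 * fY x) := by
      refine integral_congr_ae (ae_of_all _ fun x => ?_)
      simp only []
      rw [gradient_abs_rpow_mul_self_mul_pow hu1 hη hr, norm_rpow_mul_norm_sq_test hp hγ,
        hfA, hfX, hfY]
    have h2 : ∫ x, ‖gradient u x‖ ^ (p - 4) * ⟪gradient u x,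
        gradient (fun y => |u y| ^ ((γ - 1) / 2) * u y * η y ^ (k + 1)) x⟫ ^ 2 ≤
        ∫ x, ((γ + 1) ^ 2 / 4 * fA x + (k + 1) * (γ + 1) * fX x + (k + 1) ^ 2 * fY x) := by
      refine integral_mono_of_nonneg (ae_of_all _ fun x => by positivity) iQ
        (ae_of_all _ fun x => ?_)
      simp only []
      rw [gradient_abs_rpow_mul_self_mul_pow hu1 hη hr, hfA, hfX, hfY]
      exact norm_rpow_mul_inner_sq_test hp hγ (hη0 x) k _ _
    have h3 : ∫ x, V x * |u x| ^ (σ - 1) *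
        (|u x| ^ ((γ - 1) / 2) * u x * η x ^ (k + 1)) ^ 2 =
        ∫ x, V x * |u x| ^ (σ + γ) * η x ^ (2 * k + 2) := by
      refine integral_congr_ae (ae_of_all _ fun x => ?_)
      simp only []
      rw [← abs_rpow_mul_abs_rpow_mul_sq hσ1 hγ, ← abs_rpow_half_sq (γ := γ)]
      ring
    rw [h1, h3] at h
    have := mul_le_mul_of_nonneg_left h2 (show 0 ≤ p - 2 by linarith)
    linarith
  have hXY : ∀ θ : ℝ, 0 < θ → θ ≤ 1 →
      |∫ x, fX x| ≤ θ * (∫ x, fA x) + θ ^ (-(p - 1)) * (∫ x, fB x) ∧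
      ∫ x, fY x ≤ θ * (∫ x, fA x) + θ ^ (-(p - 1)) * ∫ x, fB x := by
    intro θ hθ hθ1
    have iR : Integrable fun x => θ * fA x + θ ^ (-(p - 1)) * fB x :=
      (iA.const_mul _).add (iB.const_mul _)
    rw [← integral_const_mul, ← integral_const_mul,
      ← integral_add (iA.const_mul _) (iB.const_mul _)]
    constructor
    · refine (abs_integral_le_integral_abs).trans
        (integral_mono_of_nonneg (ae_of_all _ fun x => abs_nonneg _) iR (ae_of_all _ fun x => ?_))
      have hy := young_gradient_term (norm_nonneg (gradient u x)) (abs_nonneg (u x)) (hη0 x)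
        (norm_nonneg (gradient η x)) hp hγ k 1 (2 * k + 1) hk hθ hθ1 le_rfl (by norm_num) rfl
      simp only []
      rw [hfA, hfB, hfX]
      refine le_trans ?_ hy
      rw [abs_mul, abs_mul, abs_mul, abs_mul, abs_of_nonneg (pow_nonneg (hη0 x) _),
        abs_of_nonneg (Real.rpow_nonneg (norm_nonneg _) _),
        abs_of_nonneg (Real.rpow_nonneg (abs_nonneg (u x)) _)]
      have e1 : |u x| ^ (γ - 1 + (1 : ℕ)) = |u x| ^ (γ - 1) * |u x| := by
        rw [Nat.cast_one, Real.rpow_add_of_nonneg (abs_nonneg _) (by linarith) zero_le_one,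
          Real.rpow_one]
      have e2 : ‖gradient u x‖ ^ (p - (1 : ℕ)) = ‖gradient u x‖ ^ (p - 2) * ‖gradient u x‖ := by
        rw [← Real.rpow_add_one' (norm_nonneg _) (by linarith)]
        norm_num
        ring_nf
      rw [e1, e2, pow_one, mul_assoc (‖gradient u x‖ ^ (p - 2)) ‖gradient u x‖]
      have := abs_real_inner_le_norm (gradient u x) (gradient η x)
      have := hη0 x
      gcongr
    · refine integral_mono iY iR fun x => ?_
      have hy := young_gradient_term (norm_nonneg (gradient u x)) (abs_nonneg (u x)) (hη0 x)
        (norm_nonneg (gradient η x)) hp hγ k 2 (2 * k) hk hθ hθ1 one_le_two le_rfl rfl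
      simp only []
      rw [hfA, hfB, hfY]
      rw [show γ - 1 + ((2 : ℕ) : ℝ) = γ + 1 by push_cast; ring,
        show p - ((2 : ℕ) : ℝ) = p - 2 by norm_num] at hy
      exact hy
  rw [← funext hfB]
  rw [← hW] at hS ⊢
  generalize (∫ x, fA x) = A at *
  generalize (∫ x, fX x) = X at *
  generalize (∫ x, fY x) = Y at *
  generalize (∫ x, fB x) = B at *
  obtain ⟨hX, hY⟩ := hXY τ hτ hτ1
  obtain ⟨hX1, -⟩ := hXY 1 one_pos le_rfl
  rw [Real.one_rpow, one_mul, one_mul] at hX1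
  have hτp : τ ^ (-p) = τ⁻¹ * τ ^ (-(p - 1)) := by
    rw [← Real.rpow_neg_one τ, ← Real.rpow_add hτ]
    congr 1
    ring
  have hτp1 : 1 ≤ τ ^ (-p) := Real.one_le_rpow_of_pos_of_le_one_of_nonpos hτ hτ1 (by linarith)
  have hT0 : 0 ≤ τ * A + τ ^ (-(p - 1)) * B := by positivity
  have hkk : (0 : ℝ) ≤ k + 1 := by positivity
  have hA : A ≤ τ ^ (-p) * B := by
    have h1 : ((p - 1) * (γ + 1) - 2 * σ) * X ≤
        |(p - 1) * (γ + 1) - 2 * σ| * (τ * A + τ ^ (-(p - 1)) * B) :=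
      (le_abs_self _).trans (by rw [abs_mul]; gcongr)
    have h2 : (σ * γ - (p - 1) * (γ + 1) ^ 2 / 4) * A ≤ κ * (τ * A + τ ^ (-(p - 1)) * B) := by
      have h3 := mul_le_mul_of_nonneg_left h1 hkk
      have h4 := mul_le_mul_of_nonneg_left hY
        (show 0 ≤ (p - 1) * ((k : ℝ) + 1) ^ 2 from mul_nonneg (by linarith) (sq_nonneg _))
      have h5 := mul_le_mul_of_nonneg_right hκ' hT0
      linarith
    have h6 := mul_le_mul_of_nonneg_right hδ hA0
    have h7 : κ * (τ * A) ≤ κ * (τ ^ (-(p - 1)) * B) := by linarith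
    have h8 := le_of_mul_le_mul_left h7 hκ
    rw [hτp, mul_assoc, inv_mul_eq_div, le_div_iff₀ hτ]
    linarith
  have hB1 : B ≤ τ ^ (-p) * B := le_mul_of_one_le_left hB0 hτp1
  have hX2 : X ≤ 2 * (τ ^ (-p) * B) := (le_abs_self X).trans (by linarith)
  calc γ * A + (2 * k + 2) * X
      ≤ γ * (τ ^ (-p) * B) + (2 * k + 2) * (2 * (τ ^ (-p) * B)) := by
        gcongr
    _ = (γ + 4 * (k + 1)) * τ ^ (-p) * B := by ring

end Caccioppoli

/-! ### Logarithmic cutoff functions -/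

section Cutoff

variable {m : ℕ}

/-- A smooth version of the base-two logarithm of the norm. -/
def logNorm (x : Em m) : ℝ := Real.log (1 + ‖x‖ ^ 2) / (2 * Real.log 2)

/-- A smooth cutoff equal to one where `logNorm ≤ N` and to zero where `2 N ≤ logNorm`. -/
def logCutoff (N : ℕ) (x : Em m) : ℝ := Real.smoothTransition (2 - logNorm x / N)

theorem contDiff_logNorm : ContDiff ℝ 1 (logNorm : Em m → ℝ) := by
  have h : ContDiff ℝ 1 fun x : Em m => 1 + ‖x‖ ^ 2 := contDiff_const.add (contDiff_norm_sq ℝ)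
  exact (h.log fun x => by positivity).div_const _

theorem contDiff_logCutoff (N : ℕ) : ContDiff ℝ 1 (logCutoff N : Em m → ℝ) :=
  (Real.smoothTransition.contDiff (n := 1)).comp
    (contDiff_const.sub (contDiff_logNorm.div_const _))

theorem logCutoff_nonneg (N : ℕ) (x : Em m) : 0 ≤ logCutoff N x :=
  Real.smoothTransition.nonneg _

theorem logCutoff_le_one (N : ℕ) (x : Em m) : logCutoff N x ≤ 1 :=
  Real.smoothTransition.le_one _

theorem logCutoff_eq_one {N : ℕ} (hN : 0 < N) {x : Em m} (hx : logNorm x ≤ N) :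
    logCutoff N x = 1 := by
  refine Real.smoothTransition.one_of_one_le ?_
  have hN' : (0 : ℝ) < N := by exact_mod_cast hN
  have : logNorm x / N ≤ 1 := (div_le_one hN').2 hx
  linarith

theorem logCutoff_eq_zero {N : ℕ} (hN : 0 < N) {x : Em m} (hx : 2 * N ≤ logNorm x) :
    logCutoff N x = 0 := by
  refine Real.smoothTransition.zero_of_nonpos ?_
  have hN' : (0 : ℝ) < N := by exact_mod_cast hN
  have : 2 ≤ logNorm x / N := (le_div_iff₀ hN').2 hx
  linarith

theorem natCast_le_logNorm_iff {N : ℕ} {x : Em m} :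
    (N : ℝ) ≤ logNorm x ↔ (2 : ℝ) ^ (2 * N) ≤ 1 + ‖x‖ ^ 2 := by
  have h2 : 0 < Real.log 2 := Real.log_pos one_lt_two
  rw [logNorm, le_div_iff₀ (by positivity),
    ← Real.log_le_log_iff (show (0 : ℝ) < 2 ^ (2 * N) by positivity) (by positivity), Real.log_pow]
  push_cast
  ring_nf

theorem two_pow_le_norm {N : ℕ} {x : Em m} (hx : ((N + 1 : ℕ) : ℝ) ≤ logNorm x) :
    (2 : ℝ) ^ N ≤ ‖x‖ := by
  rw [natCast_le_logNorm_iff] at hx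
  refine le_trans (le_abs_self _) (abs_le_of_sq_le_sq ?_ (norm_nonneg x))
  have h1 : (2 : ℝ) ^ (2 * (N + 1)) = 4 * ((2 : ℝ) ^ N) ^ 2 := by ring
  have h2 : (1 : ℝ) ≤ ((2 : ℝ) ^ N) ^ 2 := one_le_pow₀ (one_le_pow₀ one_le_two)
  linarith

theorem norm_lt_two_pow {N : ℕ} {x : Em m} (hx : logNorm x ≤ N) : ‖x‖ < (2 : ℝ) ^ N := by
  by_contra! h
  have h1 : ((2 : ℝ) ^ N) ^ 2 ≤ ‖x‖ ^ 2 := by gcongr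
  have h2 : (2 : ℝ) ^ (2 * N) < 1 + ‖x‖ ^ 2 := by
    rw [mul_comm, pow_mul]; linarith
  have h3 : 0 < Real.log 2 := Real.log_pos one_lt_two
  have h4 := Real.log_lt_log (by positivity) h2
  rw [logNorm, div_le_iff₀ (by positivity)] at hx
  rw [Real.log_pow] at h4
  push_cast at h4
  linarith

theorem hasCompactSupport_logCutoff {N : ℕ} (hN : 0 < N) :
    HasCompactSupport (logCutoff N : Em m → ℝ) := by
  refine HasCompactSupport.intro (isCompact_closedBall (0 : Em m) (2 ^ (2 * N))) fun x hx => ?_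
  refine logCutoff_eq_zero hN (le_of_not_ge fun h => hx ?_)
  rw [mem_closedBall_zero_iff]
  exact (norm_lt_two_pow (by push_cast; exact h)).le

theorem exists_abs_deriv_smoothTransition_le :
    ∃ C : ℝ, 0 < C ∧ ∀ s, |deriv Real.smoothTransition s| ≤ C := by
  have hcont : Continuous (deriv Real.smoothTransition) :=
    (Real.smoothTransition.contDiff (n := 1)).continuous_deriv le_rfl
  obtain ⟨C, hC⟩ := (isCompact_Icc (a := (0 : ℝ)) (b := 1)).exists_bound_of_continuousOn
    hcont.continuousOn
  refine ⟨max C 1, by positivity, fun s => ?_⟩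
  by_cases hs : s ∈ Icc (0 : ℝ) 1
  · exact (hC s hs).trans (le_max_left _ _)
  · have h0 : deriv Real.smoothTransition s = 0 := by
      rw [mem_Icc, not_and_or, not_le, not_le] at hs
      rcases hs with hs | hs
      · have : Real.smoothTransition =ᶠ[nhds s] fun _ => 0 := by
          filter_upwards [Iio_mem_nhds hs] with y hy
          exact Real.smoothTransition.zero_of_nonpos hy.le
        rw [this.deriv_eq, deriv_const]
      · have : Real.smoothTransition =ᶠ[nhds s] fun _ => 1 := by
          filter_upwards [Ioi_mem_nhds hs] with y hy
          exact Real.smoothTransition.one_of_one_le hy.le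
        rw [this.deriv_eq, deriv_const]
    rw [h0, abs_zero]
    positivity

theorem gradient_logCutoff_eq_zero {N : ℕ} (hN : 0 < N) {x : Em m}
    (hx : ¬ ((N : ℝ) ≤ logNorm x ∧ logNorm x ≤ 2 * N)) : gradient (logCutoff N) x = 0 := by
  have hc : Continuous (logNorm : Em m → ℝ) := contDiff_logNorm.continuous
  rw [not_and_or, not_le, not_le] at hx
  rcases hx with hx | hx
  · have : logCutoff N =ᶠ[nhds x] fun _ => 1 := by
      filter_upwards [hc.continuousAt.eventually_lt_const hx] with y hy
      exact logCutoff_eq_one hN hy.le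
    rw [this.gradient_eq, gradient_fun_const]
  · have : logCutoff N =ᶠ[nhds x] fun _ => 0 := by
      filter_upwards [hc.continuousAt.eventually_const_lt hx] with y hy
      exact logCutoff_eq_zero hN hy.le
    rw [this.gradient_eq, gradient_fun_const]

theorem exists_norm_gradient_logCutoff_le :
    ∃ C : ℝ, 0 < C ∧ ∀ N : ℕ, 0 < N → ∀ x : Em m,
      N * ‖gradient (logCutoff N) x‖ * ‖x‖ ≤ C := by
  obtain ⟨C, hC, hderiv⟩ := exists_abs_deriv_smoothTransition_le
  have h2 : 0 < Real.log 2 := Real.log_pos one_lt_two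
  refine ⟨C / Real.log 2, by positivity, fun N hN x => ?_⟩
  have hN' : (0 : ℝ) < N := by exact_mod_cast hN
  have hpos : 0 < 1 + ‖x‖ ^ 2 := by positivity
  have h1 : HasFDerivAt (fun y : Em m => 1 + ‖y‖ ^ 2) (2 • innerSL ℝ x) x :=
    (hasStrictFDerivAt_norm_sq x).hasFDerivAt.const_add 1
  have h3 := (Real.hasDerivAt_log hpos.ne').comp_hasFDerivAt x h1
  have h4 : HasFDerivAt (fun y : Em m => 2 - logNorm y / N)
      (-((N : ℝ)⁻¹ • ((2 * Real.log 2)⁻¹ • ((1 + ‖x‖ ^ 2)⁻¹ • (2 • innerSL ℝ x))))) x := by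
    have := (((h3.mul_const (2 * Real.log 2)⁻¹).mul_const (N : ℝ)⁻¹).const_sub 2)
    simpa only [logNorm, div_eq_mul_inv, Function.comp] using this
  have h5 : HasFDerivAt (logCutoff N) _ x :=
    (((Real.smoothTransition.contDiff (n := 1)).differentiable one_ne_zero
      (2 - logNorm x / N)).hasDerivAt).comp_hasFDerivAt x h4
  have h6 : ‖gradient (logCutoff N) x‖ = ‖fderiv ℝ (logCutoff N) x‖ := by
    simp [gradient]
  rw [h6, h5.fderiv, norm_smul, norm_neg, norm_smul, norm_smul, norm_smul, Real.norm_eq_abs]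
  have h7 : ‖(2 : ℕ) • innerSL ℝ x‖ ≤ 2 * ‖x‖ := by
    refine (norm_nsmul_le).trans ?_
    simp
  have h8 : ‖(1 + ‖x‖ ^ 2)⁻¹‖ = (1 + ‖x‖ ^ 2)⁻¹ := by
    rw [Real.norm_of_nonneg (by positivity)]
  have h9 : ‖(2 * Real.log 2)⁻¹‖ = (2 * Real.log 2)⁻¹ := by
    rw [Real.norm_of_nonneg (by positivity)]
  have h10 : ‖(N : ℝ)⁻¹‖ = (N : ℝ)⁻¹ := by
    rw [Real.norm_of_nonneg (by positivity)]
  rw [h8, h9, h10]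
  have h11 : (1 + ‖x‖ ^ 2)⁻¹ * (‖x‖ * ‖x‖) ≤ 1 := by
    rw [inv_mul_le_iff₀ hpos]
    nlinarith [norm_nonneg x]
  calc (N : ℝ) * (|deriv Real.smoothTransition (2 - logNorm x / N)| *
        ((N : ℝ)⁻¹ * ((2 * Real.log 2)⁻¹ * ((1 + ‖x‖ ^ 2)⁻¹ * ‖(2 : ℕ) • innerSL ℝ x‖)))) * ‖x‖
      ≤ (N : ℝ) * (C * ((N : ℝ)⁻¹ * ((2 * Real.log 2)⁻¹ *
          ((1 + ‖x‖ ^ 2)⁻¹ * (2 * ‖x‖))))) * ‖x‖ := by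
        gcongr
        exact hderiv _
    _ = C / Real.log 2 * ((1 + ‖x‖ ^ 2)⁻¹ * (‖x‖ * ‖x‖)) := by
        field_simp
    _ ≤ C / Real.log 2 * 1 := by gcongr
    _ = C / Real.log 2 := mul_one _

end Cutoff

/-! ### The critical exponents -/

section Exponents

variable {p σ : ℝ}

theorem one_lt_gammaBar (hp : 2 ≤ p) (hσ : p - 1 < σ) : 1 < gammaBar p σ := by
  rw [gammaBar, lt_div_iff₀ (by linarith)]
  have := Real.sqrt_nonneg (σ * (σ - p + 1))
  linarith

theorem stability_gap_gammaBar_sub (hp : 2 ≤ p) (hσ : p - 1 < σ) (x : ℝ) :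
    σ * (gammaBar p σ - x) - (p - 1) * (gammaBar p σ - x + 1) ^ 2 / 4 =
      x * (√(σ * (σ - p + 1)) - (p - 1) * x / 4) := by
  have hq : √(σ * (σ - p + 1)) ^ 2 = σ * (σ - p + 1) :=
    Real.sq_sqrt (mul_nonneg (by linarith) (by linarith))
  have hP : p - 1 ≠ 0 := by linarith
  rw [gammaBar]
  generalize √(σ * (σ - p + 1)) = q at *
  field_simp
  linear_combination (-4) * hq

theorem betaC_pos (hp : 2 ≤ p) (hσ : p - 1 < σ) : 0 < betaC p σ :=
  div_pos (by linarith [one_lt_gammaBar hp hσ]) (by linarith)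

theorem alphaC_eq (hσ : p - 1 < σ) : alphaC p σ = p * (1 + betaC p σ) := by
  have : σ - p + 1 ≠ 0 := by linarith
  rw [alphaC, betaC]
  field_simp
  ring

end Exponents

section UniformEstimate

variable {m : ℕ} {p σ : ℝ} {V u : Em m → ℝ}

theorem exists_integral_potential_le (hp : 2 ≤ p) (hσ : p - 1 < σ)
    (hu : IsWeakSol p σ V u) (hst : IsStable p σ V u) (k : ℕ) (hk : p ≤ 2 * k + 2) :
    ∃ K ε₁ : ℝ, 0 < K ∧ 0 < ε₁ ∧ ∀ ε, 0 < ε → ε < ε₁ →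
      1 < gammaBar p σ - (σ - p + 1) * ε ∧
      ∀ η : Em m → ℝ, ContDiff ℝ 1 η → HasCompactSupport η → (∀ x, 0 ≤ η x) →
        ∫ x, V x * |u x| ^ (σ + (gammaBar p σ - (σ - p + 1) * ε)) * η x ^ (2 * k + 2) ≤
          K * ε ^ (-p) * ∫ x, |u x| ^ (gammaBar p σ - (σ - p + 1) * ε + p - 1) *
            ‖gradient η x‖ ^ p * η x ^ (2 * k + 2 - p) := by
  have hg := one_lt_gammaBar hp hσ
  have hgap := stability_gap_gammaBar_sub hp hσ
  have hq : 0 < √(σ * (σ - p + 1)) := Real.sqrt_pos.2 (mul_pos (by linarith) (by linarith))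
  generalize gammaBar p σ = g at *
  generalize √(σ * (σ - p + 1)) = q at *
  have hs : 0 < σ - p + 1 := by linarith
  have hP : 0 < p - 1 := by linarith
  set s := σ - p + 1 with hsdef
  obtain ⟨κ, hκ⟩ : ∃ κ : ℝ, κ = (k + 1) * ((p - 1) * (g + 1) + 2 * σ) + (p - 1) * (k + 1) ^ 2 :=
    ⟨_, rfl⟩
  have hκ0 : 0 < κ := by
    rw [hκ]
    have : 0 < (p - 1) * (g + 1) + 2 * σ := by
      have := mul_pos hP (show 0 < g + 1 by linarith)
      linarith
    positivity
  obtain ⟨c, hc⟩ : ∃ c : ℝ, c = s * q / (4 * κ) := ⟨_, rfl⟩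
  have hc0 : 0 < c := by rw [hc]; positivity
  refine ⟨(g + 4 * (k + 1)) * c ^ (-p), min ((g - 1) / s) (min (2 * q / ((p - 1) * s)) c⁻¹),
    ?_, ?_, fun ε hε hε1 => ?_⟩
  · have : 0 < c ^ (-p) := Real.rpow_pos_of_pos hc0 _
    have : 0 < g + 4 * ((k : ℝ) + 1) := by
      have : (0 : ℝ) ≤ k := k.cast_nonneg
      linarith
    positivity
  · have : 0 < g - 1 := by linarith
    exact lt_min (by positivity) (lt_min (by positivity) (by positivity))
  · obtain ⟨h1, h2, h3⟩ : ε < (g - 1) / s ∧ ε < 2 * q / ((p - 1) * s) ∧ ε < c⁻¹ := by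
      simpa [lt_min_iff] using hε1
    rw [lt_div_iff₀ hs] at h1
    rw [lt_div_iff₀ (by positivity)] at h2
    have h3' : c * ε ≤ 1 := by
      rw [← le_inv_mul_iff₀ hc0, mul_one]; exact h3.le
    have hsε : 0 < s * ε := by positivity
    have hγ : 1 < g - s * ε := by linarith
    refine ⟨hγ, fun η hη hηc hη0 => ?_⟩
    have key := integral_potential_le_caccioppoli hp hσ hu hst hη hηc hη0 hγ k hk hκ0
      (τ := c * ε) ?_ (by positivity) h3' ?_
    · refine key.trans ?_
      have hint : 0 ≤ ∫ x, |u x| ^ (g - s * ε + p - 1) * ‖gradient η x‖ ^ p *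
          η x ^ (2 * k + 2 - p) := integral_nonneg fun x => by
        have := hη0 x
        positivity
      rw [Real.mul_rpow hc0.le hε.le, ← mul_assoc]
      gcongr
      linarith
    · rw [hκ]
      have : |(p - 1) * (g - s * ε + 1) - 2 * σ| ≤ (p - 1) * (g + 1) + 2 * σ := by
        have h4 : 0 < (p - 1) * (g - s * ε + 1) := mul_pos hP (by linarith)
        have h5 : (p - 1) * (g - s * ε + 1) ≤ (p - 1) * (g + 1) := by gcongr; linarith
        rw [abs_le]
        constructor <;> linarith
      gcongr
    · rw [hgap (s * ε)]
      have : 2 * κ * (c * ε) = (s * ε) * (q / 2) := by rw [hc]; field_simp; ring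
      rw [this]
      gcongr
      linarith

end UniformEstimate

section Annulus

variable {m : ℕ} {p σ : ℝ} {V : Em m → ℝ}

theorem lintegral_biUnion_finset_le_sum {X ι : Type*} [MeasurableSpace X] {μ : Measure X}
    (s : Finset ι) (A : ι → Set X) (f : X → ℝ≥0∞) :
    ∫⁻ x in ⋃ i ∈ s, A i, f x ∂μ ≤ ∑ i ∈ s, ∫⁻ x in A i, f x ∂μ := by
  classical
  induction s using Finset.induction_on with
  | empty => simp
  | insert i s hi ih =>
    rw [Finset.sum_insert hi, Finset.set_biUnion_insert]
    exact (lintegral_union_le _ _ _).trans (add_le_add le_rfl ih)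

theorem dyadic_annulus_subset {N : ℕ} (hN : 0 < N) :
    {x : Em m | (2 : ℝ) ^ (N - 1) ≤ ‖x‖ ∧ ‖x‖ < 2 ^ (2 * N)} ⊆
      ⋃ j ∈ Finset.Icc N (2 * N), ball (0 : Em m) (2 ^ j) \ ball 0 (2 ^ j / 2) := by
  classical
  rintro x ⟨h1, h2⟩
  have hex : ∃ j : ℕ, ‖x‖ < 2 ^ j := ⟨_, h2⟩
  have hj := Nat.find_spec hex
  have hle := Nat.find_min' hex h2
  have hmin := fun i => Nat.find_min hex (m := i)
  generalize Nat.find hex = j at *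
  have hNj : N ≤ j := by
    by_contra! h
    have : (2 : ℝ) ^ j ≤ 2 ^ (N - 1) := pow_le_pow_right₀ one_le_two (by omega)
    linarith
  simp only [mem_iUnion, Finset.mem_Icc, Set.mem_sdiff, mem_ball_zero_iff, exists_prop]
  refine ⟨j, ⟨hNj, hle⟩, hj, ?_⟩
  have h3 := hmin (j - 1) (by omega)
  obtain ⟨i, rfl⟩ : ∃ i, j = i + 1 := ⟨j - 1, by omega⟩
  rw [pow_succ, mul_div_assoc, div_self two_ne_zero, mul_one]
  simpa using h3

theorem lintegral_dyadic_shell_le {C C₀ q ε R : ℝ} (hR : 0 < R) (hq : 0 ≤ q)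
    (hqα : q = alphaC p σ - p * ε) (hqle : q ≤ alphaC p σ)
    (h : (∫⁻ x in ball (0 : Em m) R \ ball (0 : Em m) (R / 2),
        ENNReal.ofReal (V x ^ (-(betaC p σ) + ε))) ≤
      ENNReal.ofReal (C * R ^ (alphaC p σ + C₀ * ε) * (Real.log R)⁻¹)) :
    (∫⁻ x in ball (0 : Em m) R \ ball (0 : Em m) (R / 2),
        ENNReal.ofReal (‖x‖ ^ (-q)) * ENNReal.ofReal (V x ^ (-(betaC p σ) + ε))) ≤
      ENNReal.ofReal (2 ^ alphaC p σ * (C * R ^ ((p + C₀) * ε) * (Real.log R)⁻¹)) := by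
  have hpt : ∀ x ∈ ball (0 : Em m) R \ ball (0 : Em m) (R / 2),
      ENNReal.ofReal (‖x‖ ^ (-q)) * ENNReal.ofReal (V x ^ (-(betaC p σ) + ε)) ≤
        ENNReal.ofReal (2 ^ alphaC p σ * R ^ (-q)) *
          ENNReal.ofReal (V x ^ (-(betaC p σ) + ε)) := by
    rintro x ⟨-, hx⟩
    rw [mem_ball_zero_iff, not_lt] at hx
    gcongr
    calc ‖x‖ ^ (-q) ≤ (R / 2) ^ (-q) :=
          Real.rpow_le_rpow_of_nonpos (by positivity) hx (by linarith)
      _ = 2 ^ q * R ^ (-q) := by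
          rw [Real.div_rpow hR.le zero_le_two, Real.rpow_neg zero_le_two, div_inv_eq_mul, mul_comm]
      _ ≤ 2 ^ alphaC p σ * R ^ (-q) := by
          gcongr
          exact one_le_two
  calc _ ≤ ∫⁻ x in ball (0 : Em m) R \ ball (0 : Em m) (R / 2),
        ENNReal.ofReal (2 ^ alphaC p σ * R ^ (-q)) * ENNReal.ofReal (V x ^ (-(betaC p σ) + ε)) :=
        setLIntegral_mono' (measurableSet_ball.diff measurableSet_ball) hpt
    _ = ENNReal.ofReal (2 ^ alphaC p σ * R ^ (-q)) *
        ∫⁻ x in ball (0 : Em m) R \ ball (0 : Em m) (R / 2),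
          ENNReal.ofReal (V x ^ (-(betaC p σ) + ε)) :=
        lintegral_const_mul' _ _ ENNReal.ofReal_ne_top
    _ ≤ ENNReal.ofReal (2 ^ alphaC p σ * R ^ (-q)) *
        ENNReal.ofReal (C * R ^ (alphaC p σ + C₀ * ε) * (Real.log R)⁻¹) := by gcongr
    _ = _ := by
        rw [← ENNReal.ofReal_mul (by positivity)]
        congr 1
        have : R ^ ((p + C₀) * ε) = R ^ (-q) * R ^ (alphaC p σ + C₀ * ε) := by
          rw [← Real.rpow_add hR, hqα]
          congr 1
          ring
        rw [this]
        ring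

theorem exists_lintegral_annulus_le (hp : 2 ≤ p) (hσ : p - 1 < σ) (hV : HP1 p σ V)
    {t : ℝ} (ht : 0 < t) :
    ∃ K : ℝ, 0 < K ∧ ∃ N₀ : ℕ, ∀ N ≥ N₀,
      (∫⁻ x in {x : Em m | (2 : ℝ) ^ (N - 1) ≤ ‖x‖ ∧ ‖x‖ < 2 ^ (2 * N)},
        ENNReal.ofReal (‖x‖ ^ (-(alphaC p σ - p * (t / N)))) *
          ENNReal.ofReal (V x ^ (-(betaC p σ) + t / N))) ≤ ENNReal.ofReal K := by
  obtain ⟨C, C₀, R₀, ε₀, hC, hC₀, hR₀, hε₀, hHP⟩ := hV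
  have hα : 0 < alphaC p σ := by
    rw [alphaC_eq hσ]
    have := betaC_pos hp hσ
    have : 0 < p := by linarith
    positivity
  have hlog2 : 0 < Real.log 2 := Real.log_pos one_lt_two
  have hlim : Tendsto (fun N : ℕ => t / (N : ℝ)) atTop (nhds 0) :=
    tendsto_const_div_atTop_nhds_zero_nat t
  have hpow : Tendsto (fun N : ℕ => (2 : ℝ) ^ N) atTop atTop :=
    tendsto_pow_atTop_atTop_of_one_lt one_lt_two
  have hev : ∀ᶠ N : ℕ in atTop, t / (N : ℝ) < ε₀ ∧ t / (N : ℝ) < alphaC p σ / p ∧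
      R₀ < (2 : ℝ) ^ N ∧ 1 ≤ N := by
    filter_upwards [hlim.eventually_lt_const hε₀,
      hlim.eventually_lt_const (show 0 < alphaC p σ / p by positivity),
      hpow.eventually_gt_atTop R₀, eventually_ge_atTop 1] with N h1 h2 h3 h4
    exact ⟨h1, h2, h3, h4⟩
  obtain ⟨N₀, hN₀⟩ := eventually_atTop.1 hev
  obtain ⟨M, hM⟩ : ∃ M : ℝ, M = 2 ^ alphaC p σ * (C * 2 ^ (2 * (p + C₀) * t) * (Real.log 2)⁻¹) :=
    ⟨_, rfl⟩
  have hM0 : 0 < M := by rw [hM]; positivity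
  refine ⟨2 * M, by positivity, N₀, fun N hN => ?_⟩
  obtain ⟨h1, h2, h3, h4⟩ := hN₀ N hN
  have hN' : (0 : ℝ) < N := by exact_mod_cast h4
  have hε : 0 < t / (N : ℝ) := by positivity
  have hshell : ∀ j ∈ Finset.Icc N (2 * N),
      (∫⁻ x in ball (0 : Em m) (2 ^ j) \ ball 0 (2 ^ j / 2),
        ENNReal.ofReal (‖x‖ ^ (-(alphaC p σ - p * (t / N)))) *
          ENNReal.ofReal (V x ^ (-(betaC p σ) + t / N))) ≤ ENNReal.ofReal (M / N) := by
    intro j hj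
    rw [Finset.mem_Icc] at hj
    have hRj : R₀ < (2 : ℝ) ^ j := h3.trans_le (pow_le_pow_right₀ one_le_two hj.1)
    have hj' : (N : ℝ) ≤ j := by exact_mod_cast hj.1
    have hj2 : (j : ℝ) ≤ 2 * N := by exact_mod_cast hj.2
    refine (lintegral_dyadic_shell_le (by positivity) ?_ rfl ?_
      (hHP (t / N) ⟨hε, h1⟩ (2 ^ j) hRj)).trans (ENNReal.ofReal_le_ofReal ?_)
    · rw [lt_div_iff₀ (by linarith)] at h2
      linarith
    · have : 0 < p * (t / N) := by positivity
      linarith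
    · rw [Real.log_pow, ← Real.rpow_natCast, ← Real.rpow_mul zero_le_two, hM]
      have e1 : (2 : ℝ) ^ ((j : ℝ) * ((p + C₀) * (t / N))) ≤ 2 ^ (2 * (p + C₀) * t) := by
        refine Real.rpow_le_rpow_of_exponent_le one_le_two ?_
        calc (j : ℝ) * ((p + C₀) * (t / N)) ≤ (2 * N) * ((p + C₀) * (t / N)) := by gcongr
          _ = 2 * (p + C₀) * t := by field_simp
      have e2 : ((j : ℝ) * Real.log 2)⁻¹ ≤ ((N : ℝ) * Real.log 2)⁻¹ := by gcongr
      calc _ ≤ 2 ^ alphaC p σ * (C * 2 ^ (2 * (p + C₀) * t) * ((N : ℝ) * Real.log 2)⁻¹) := by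
            gcongr
        _ = _ := by field_simp
  calc _ ≤ _ := lintegral_mono_set (dyadic_annulus_subset h4)
    _ ≤ _ := lintegral_biUnion_finset_le_sum _ _ _
    _ ≤ ∑ j ∈ Finset.Icc N (2 * N), ENNReal.ofReal (M / N) := Finset.sum_le_sum hshell
    _ = ENNReal.ofReal ((N + 1) * (M / N)) := by
        rw [Finset.sum_const, Nat.card_Icc, nsmul_eq_mul, ENNReal.ofReal_mul (by positivity)]
        congr 1
        rw [show 2 * N + 1 - N = N + 1 by omega]
        exact (ENNReal.ofReal_natCast (N + 1)).symm.trans (by push_cast; rfl)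
    _ ≤ ENNReal.ofReal (2 * M) := by
        refine ENNReal.ofReal_le_ofReal ?_
        have : (1 : ℝ) ≤ N := by exact_mod_cast h4
        rw [mul_div_assoc', div_le_iff₀ hN']
        nlinarith

end Annulus

/-! ### Estimates with logarithmic cutoffs -/

section CutoffEstimates

variable {m : ℕ} {p σ : ℝ} {V u : Em m → ℝ}

/-- The region where the gradient of `logCutoff N` may be nonzero. -/
def logShell (m N : ℕ) : Set (Em m) := {x | (N : ℝ) ≤ logNorm x ∧ logNorm x ≤ 2 * N}

theorem measurableSet_logShell (N : ℕ) : MeasurableSet (logShell m N) := by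
  have hc : Continuous (logNorm : Em m → ℝ) := contDiff_logNorm.continuous
  exact ((isClosed_le continuous_const hc).inter (isClosed_le hc continuous_const)).measurableSet

theorem logShell_subset {N : ℕ} (hN : 0 < N) :
    logShell m N ⊆ {x : Em m | (2 : ℝ) ^ (N - 1) ≤ ‖x‖ ∧ ‖x‖ < 2 ^ (2 * N)} := by
  rintro x ⟨h1, h2⟩
  refine ⟨two_pow_le_norm ?_, norm_lt_two_pow (by push_cast; exact h2)⟩
  rwa [Nat.sub_add_cancel hN]

theorem weight_rpow_le {K C t N G X p θ Θ : ℝ} (hK : 0 < K) (ht : 0 < t) (hN : 0 < N)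
    (hG : 0 ≤ G) (hX : 0 < X) (hp : 0 ≤ p) (hθ : 0 ≤ θ) (hθΘ : θ ≤ Θ) (h : N * G * X ≤ C) :
    (K * (t / N) ^ (-p) * G ^ p) ^ θ ≤ max (K * (C / t) ^ p) 1 ^ Θ * X ^ (-(p * θ)) := by
  have hC : 0 ≤ C := le_trans (by positivity) h
  have h1 : (t / N) ^ (-p) * G ^ p ≤ (C / t) ^ p * X ^ (-p) := by
    rw [Real.rpow_neg (by positivity), Real.rpow_neg hX.le, ← Real.inv_rpow (by positivity),
      ← Real.inv_rpow hX.le, ← Real.mul_rpow (by positivity) hG,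
      ← Real.mul_rpow (by positivity) (by positivity)]
    refine Real.rpow_le_rpow (by positivity) ?_ hp
    rw [inv_div, div_mul_eq_mul_div, div_mul_eq_mul_div]
    refine div_le_div_of_nonneg_right ?_ ht.le
    rw [← div_eq_mul_inv, le_div_iff₀ hX]
    exact h
  calc (K * (t / N) ^ (-p) * G ^ p) ^ θ
      ≤ (max (K * (C / t) ^ p) 1 * X ^ (-p)) ^ θ := by
        refine Real.rpow_le_rpow (by positivity) ?_ hθ
        calc K * (t / N) ^ (-p) * G ^ p ≤ K * ((C / t) ^ p * X ^ (-p)) := by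
              rw [mul_assoc]; gcongr
          _ = K * (C / t) ^ p * X ^ (-p) := by ring
          _ ≤ _ := by gcongr; exact le_max_left _ _
    _ = max (K * (C / t) ^ p) 1 ^ θ * X ^ (-(p * θ)) := by
        rw [Real.mul_rpow (by positivity) (by positivity), ← Real.rpow_mul hX.le]
        congr 2
        ring
    _ ≤ _ := by
        gcongr
        exact le_max_right _ _

theorem integrable_and_integral_le_of_lintegral_le {X : Type*} [MeasurableSpace X]
    {μ : Measure X} {f : X → ℝ} {K : ℝ} (hK : 0 ≤ K) (hf : AEStronglyMeasurable f μ)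
    (hf0 : 0 ≤ᵐ[μ] f) (h : ∫⁻ x, ENNReal.ofReal (f x) ∂μ ≤ ENNReal.ofReal K) :
    Integrable f μ ∧ ∫ x, f x ∂μ ≤ K := by
  refine ⟨⟨hf, ?_⟩, ?_⟩
  · rw [hasFiniteIntegral_iff_ofReal hf0]
    exact h.trans_lt ENNReal.ofReal_lt_top
  · rw [integral_eq_lintegral_of_nonneg_ae hf0 hf]
    exact ENNReal.toReal_le_of_le_ofReal hK h

theorem exists_integral_cutoff_le (hp : 2 ≤ p) (hσ : p - 1 < σ)
    (hVloc : LocallyIntegrable V volume) (hVpos : ∀ᵐ x : Em m, 0 < V x) (hHP : HP1 p σ V)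
    (hu : IsWeakSol p σ V u) (hst : IsStable p σ V u) {k : ℕ} (hk : alphaC p σ < 2 * k + 2)
    {t : ℝ} (ht : 0 < t) :
    ∃ K : ℝ, 0 < K ∧ ∀ᶠ N : ℕ in atTop, ∀ μ : ℝ, 0 < μ →
      ∫ x, V x * |u x| ^ (σ + gammaBar p σ - (σ - p + 1) * (t / N)) *
          logCutoff N x ^ (2 * k + 2) ≤
        μ * (∫ x in logShell m N, V x * |u x| ^ (σ + gammaBar p σ - (σ - p + 1) * (t / N)) *
          logCutoff N x ^ (2 * k + 2)) + K * μ ^ (-(betaC p σ - t / N)) := by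
  have hβ := betaC_pos hp hσ
  have hαβ := alphaC_eq hσ
  have hp0 : 0 < p := by linarith
  have hpk : p ≤ 2 * k + 2 := by
    have := mul_pos hp0 hβ
    linarith
  obtain ⟨K₁, ε₁, hK₁, hε₁, hcacc⟩ := exists_integral_potential_le hp hσ hu hst k hpk
  obtain ⟨C, hC, hgrad⟩ := exists_norm_gradient_logCutoff_le (m := m)
  obtain ⟨K₂, hK₂, N₂, hann⟩ := exists_lintegral_annulus_le hp hσ hHP ht
  obtain ⟨K₃, hK₃⟩ : ∃ K : ℝ, K = max (K₁ * (C / t) ^ p) 1 ^ (1 + betaC p σ) := ⟨_, rfl⟩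
  have hK₃0 : 0 < K₃ := by rw [hK₃]; positivity
  have hlim : Tendsto (fun N : ℕ => t / (N : ℝ)) atTop (nhds 0) :=
    tendsto_const_div_atTop_nhds_zero_nat t
  refine ⟨K₃ * K₂, by positivity, ?_⟩
  filter_upwards [eventually_ge_atTop N₂, eventually_ge_atTop 1, hlim.eventually_lt_const hε₁,
    hlim.eventually_lt_const hβ] with N hNN₂ hN hNε hNβ μ hμ
  have hN' : (0 : ℝ) < N := by exact_mod_cast hN
  have hε : 0 < t / (N : ℝ) := by positivity
  have hs : 0 < σ - p + 1 := by linarith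
  obtain ⟨hγ, hcacc⟩ := hcacc _ hε hNε
  have hcacc := hcacc (logCutoff N) (contDiff_logCutoff N) (hasCompactSupport_logCutoff hN)
    (logCutoff_nonneg N)
  obtain ⟨e, he⟩ : ∃ e : ℝ, e = gammaBar p σ - (σ - p + 1) * (t / N) + p - 1 := ⟨_, rfl⟩
  have hes : e / (σ - p + 1) = betaC p σ - t / N := by
    rw [he, betaC]
    field_simp
    ring
  have he0 : 0 < e := by linarith
  have hea : e + (σ - p + 1) = σ + gammaBar p σ - (σ - p + 1) * (t / N) := by rw [he]; ring
  rw [← he, ← add_sub_assoc, ← hea, ← integral_const_mul] at hcacc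
  rw [← hea]
  have hf : Integrable fun x => V x * |u x| ^ (e + (σ - p + 1)) * logCutoff N x ^ (2 * k + 2) :=
    integrable_potential_mul hVloc hu.1.continuous (contDiff_logCutoff N).continuous
      (hasCompactSupport_logCutoff hN) (by linarith) (by omega)
  obtain ⟨g, hg⟩ : ∃ g : Em m → ℝ, ∀ x, g x =
    ‖x‖ ^ (-(alphaC p σ - p * (t / N))) * V x ^ (-(betaC p σ) + t / N) := ⟨_, fun _ => rfl⟩
  have hgint : IntegrableOn g (logShell m N) ∧ ∫ x in logShell m N, g x ≤ K₂ := by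
    have hVm : AEMeasurable V := hVloc.aestronglyMeasurable.aemeasurable
    refine integrable_and_integral_le_of_lintegral_le hK₂.le ?_ ?_ ?_
    · rw [funext hg]
      refine AEMeasurable.aestronglyMeasurable (AEMeasurable.restrict ?_)
      exact (Measurable.aemeasurable (by fun_prop)).mul (hVm.pow_const _)
    · refine ae_restrict_of_ae ?_
      filter_upwards [hVpos] with x hx
      rw [hg]
      exact mul_nonneg (by positivity) (by positivity)
    · refine (lintegral_mono_set (logShell_subset hN)).trans
        (le_trans (le_of_eq ?_) (hann N hNN₂))
      refine lintegral_congr fun x => ?_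
      rw [hg, ENNReal.ofReal_mul (by positivity)]
  have hS := measurableSet_logShell (m := m) N
  calc _ ≤ _ := hcacc
    _ ≤ ∫ x, (μ * (logShell m N).indicator (fun x => V x * |u x| ^ (e + (σ - p + 1)) *
          logCutoff N x ^ (2 * k + 2)) x +
          K₃ * μ ^ (-(betaC p σ - t / N)) * (logShell m N).indicator g x) := by
        refine integral_mono_of_nonneg (ae_of_all _ fun x => ?_) ?_ ?_
        · have := logCutoff_nonneg N x
          simp only [Pi.zero_apply]
          positivity
        · exact ((hf.indicator hS).const_mul _).add
            ((hgint.1.integrable_indicator hS).const_mul _)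
        · filter_upwards [hVpos] with x hx
          by_cases hxS : x ∈ logShell m N
          · rw [indicator_of_mem hxS, indicator_of_mem hxS, hg]
            have hx0 : 0 < ‖x‖ := lt_of_lt_of_le (by positivity) (logShell_subset hN hxS).1
            have hw := weight_rpow_le (θ := 1 + e / (σ - p + 1)) (Θ := 1 + betaC p σ) hK₁ ht hN'
              (norm_nonneg (gradient (logCutoff N) x)) hx0 hp0.le (by positivity)
              (by rw [hes]; linarith) (hgrad N hN x)
            rw [← hK₃] at hw
            have hy := young_potential_term (W := K₁ * (t / N) ^ (-p) *
              ‖gradient (logCutoff N) x‖ ^ p) (by positivity) (abs_nonneg (u x))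
              (logCutoff_nonneg N x) (logCutoff_le_one N x) hx hμ he0 hs hp0
              (l := ((2 * k + 2 : ℕ) : ℝ)) (by
                have : 0 < p * (t / N) := by positivity
                rw [hes]; push_cast; linarith)
            rw [Real.rpow_natCast] at hy
            have hexp : p * (1 + e / (σ - p + 1)) = alphaC p σ - p * (t / N) := by
              rw [hes, hαβ]; ring
            rw [hexp] at hw
            calc _ = K₁ * (t / N) ^ (-p) * ‖gradient (logCutoff N) x‖ ^ p *
                  (|u x| ^ e * logCutoff N x ^ (((2 * k + 2 : ℕ) : ℝ) - p)) := by
                    push_cast; ring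
              _ ≤ _ := hy
              _ ≤ μ * (V x * |u x| ^ (e + (σ - p + 1)) * logCutoff N x ^ (2 * k + 2)) +
                  K₃ * ‖x‖ ^ (-(alphaC p σ - p * (t / N))) *
                    (μ * V x) ^ (-(e / (σ - p + 1))) := by
                    gcongr
              _ = _ := by
                  rw [hes, Real.mul_rpow hμ.le hx.le, neg_sub' (betaC p σ), sub_neg_eq_add]
                  ring
          · rw [indicator_of_notMem hxS, indicator_of_notMem hxS,
              gradient_logCutoff_eq_zero hN hxS, norm_zero, Real.zero_rpow hp0.ne']
            simp
    _ = μ * (∫ x in logShell m N, V x * |u x| ^ (e + (σ - p + 1)) *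
          logCutoff N x ^ (2 * k + 2)) +
        K₃ * μ ^ (-(betaC p σ - t / N)) * ∫ x in logShell m N, g x := by
        rw [integral_add ((hf.indicator hS).const_mul _)
          ((hgint.1.integrable_indicator hS).const_mul _), integral_const_mul, integral_const_mul,
          integral_indicator hS, integral_indicator hS]
    _ ≤ μ * (∫ x in logShell m N, V x * |u x| ^ (e + (σ - p + 1)) *
          logCutoff N x ^ (2 * k + 2)) + K₃ * μ ^ (-(betaC p σ - t / N)) * K₂ := by
        gcongr
        exact hgint.2
    _ = _ := by ring

end CutoffEstimates

section Vanishing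

variable {m : ℕ} {p σ : ℝ} {V u : Em m → ℝ}

theorem tendsto_sub_mul_div_natCast (a s t : ℝ) :
    Tendsto (fun N : ℕ => a - s * (t / N)) atTop (nhds a) := by
  simpa using tendsto_const_nhds.sub ((tendsto_const_div_atTop_nhds_zero_nat t).const_mul s)

theorem eventually_lt_natCast {c : ℝ} : ∀ᶠ N : ℕ in atTop, c < N :=
  tendsto_natCast_atTop_atTop.eventually_gt_atTop c

/-- Fatou's lemma along the cutoffs. -/
theorem lintegral_potential_le (hVloc : LocallyIntegrable V volume)
    (hVpos : ∀ᵐ x : Em m, 0 < V x) (hu : Continuous u) {a s t M : ℝ} (ha : 0 < a) {l : ℕ}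
    (hl : l ≠ 0)
    (h : ∀ᶠ N : ℕ in atTop, ∫ x, V x * |u x| ^ (a - s * (t / N)) * logCutoff N x ^ l ≤ M) :
    ∫⁻ x, ENNReal.ofReal (V x * |u x| ^ a) ≤ ENNReal.ofReal M := by
  have hexp := tendsto_sub_mul_div_natCast a s t
  have hVm : AEMeasurable V := hVloc.aestronglyMeasurable.aemeasurable
  have hpt : ∀ x : Em m, Tendsto (fun N : ℕ => ENNReal.ofReal
      (V x * |u x| ^ (a - s * (t / N)) * logCutoff N x ^ l)) atTop
      (nhds (ENNReal.ofReal (V x * |u x| ^ a))) := by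
    intro x
    refine ENNReal.tendsto_ofReal ?_
    have h1 : Tendsto (fun N : ℕ => |u x| ^ (a - s * (t / N))) atTop (nhds (|u x| ^ a)) :=
      (Real.continuousAt_const_rpow' ha.ne').tendsto.comp hexp
    have h2 : Tendsto (fun N : ℕ => V x * |u x| ^ (a - s * (t / N))) atTop
        (nhds (V x * |u x| ^ a)) := h1.const_mul _
    refine h2.congr' ?_
    filter_upwards [eventually_gt_atTop 0, eventually_lt_natCast (c := logNorm x)] with N hN hx
    rw [logCutoff_eq_one hN hx.le, one_pow, mul_one]
  calc ∫⁻ x, ENNReal.ofReal (V x * |u x| ^ a)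
      = ∫⁻ x, liminf (fun N : ℕ => ENNReal.ofReal
          (V x * |u x| ^ (a - s * (t / N)) * logCutoff N x ^ l)) atTop :=
        lintegral_congr fun x => (hpt x).liminf_eq.symm
    _ ≤ liminf (fun N : ℕ => ∫⁻ x, ENNReal.ofReal
          (V x * |u x| ^ (a - s * (t / N)) * logCutoff N x ^ l)) atTop := by
        refine lintegral_liminf_le' fun N => ?_
        have h1 : Measurable fun x => |u x| ^ (a - s * (t / N)) :=
          hu.abs.measurable.pow_const _
        have h2 : Measurable fun x : Em m => logCutoff N x ^ l :=
          ((contDiff_logCutoff N).continuous.pow l).measurable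
        exact ((hVm.mul h1.aemeasurable).mul h2.aemeasurable).ennreal_ofReal
    _ ≤ ENNReal.ofReal M := by
        refine liminf_le_of_frequently_le' (Eventually.frequently ?_)
        filter_upwards [h, eventually_gt_atTop 0, hexp.eventually_const_lt ha] with N hNM hN hNa
        rw [← ofReal_integral_eq_lintegral_ofReal]
        · exact ENNReal.ofReal_le_ofReal hNM
        · exact integrable_potential_mul hVloc hu (contDiff_logCutoff N).continuous
            (hasCompactSupport_logCutoff hN) hNa.le hl
        · filter_upwards [hVpos] with x hx
          have := logCutoff_nonneg N x
          simp only [Pi.zero_apply]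
          positivity

theorem exists_integral_cutoff_bounded (hp : 2 ≤ p) (hσ : p - 1 < σ)
    (hVloc : LocallyIntegrable V volume) (hVpos : ∀ᵐ x : Em m, 0 < V x) (hHP : HP1 p σ V)
    (hu : IsWeakSol p σ V u) (hst : IsStable p σ V u) {k : ℕ} (hk : alphaC p σ < 2 * k + 2)
    {t : ℝ} (ht : 0 < t) :
    ∃ M : ℝ, 0 < M ∧ ∀ᶠ N : ℕ in atTop,
      ∫ x, V x * |u x| ^ (σ + gammaBar p σ - (σ - p + 1) * (t / N)) *
        logCutoff N x ^ (2 * k + 2) ≤ M := by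
  obtain ⟨K, hK, hev⟩ := exists_integral_cutoff_le hp hσ hVloc hVpos hHP hu hst hk ht
  have ha : 0 < σ + gammaBar p σ := by linarith [one_lt_gammaBar hp hσ]
  refine ⟨2 * (K * 2 ^ betaC p σ), by positivity, ?_⟩
  filter_upwards [hev, eventually_gt_atTop 0,
    (tendsto_sub_mul_div_natCast (σ + gammaBar p σ) (σ - p + 1) t).eventually_const_lt ha]
    with N h hN hNa
  have hN' : (0 : ℝ) < N := by exact_mod_cast hN
  have h1 := h (1 / 2) (by norm_num)
  have h2 : (1 / 2 : ℝ) ^ (-(betaC p σ - t / N)) ≤ 2 ^ betaC p σ := by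
    rw [one_div, Real.inv_rpow zero_le_two, Real.rpow_neg zero_le_two, inv_inv]
    refine Real.rpow_le_rpow_of_exponent_le one_le_two ?_
    have : 0 < t / N := by positivity
    linarith
  have h3 := mul_le_mul_of_nonneg_left h2 hK.le
  have h4 := setIntegral_le_integral (s := logShell m N)
    (integrable_potential_mul hVloc hu.1.continuous (contDiff_logCutoff N).continuous
      (hasCompactSupport_logCutoff hN) hNa.le (show 2 * k + 2 ≠ 0 by omega)) (by
        filter_upwards [hVpos] with x hx
        have := logCutoff_nonneg N x
        simp only [Pi.zero_apply]
        positivity)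
  linarith

theorem tendsto_setIntegral_logShell {f : Em m → ℝ} (hf : Integrable f) :
    Tendsto (fun N : ℕ => ∫ x in logShell m N, f x) atTop (nhds 0) := by
  have h : Tendsto (fun N : ℕ => ∫ x, (logShell m N).indicator f x) atTop
      (nhds (∫ _ : Em m, (0 : ℝ))) := by
    refine tendsto_integral_of_dominated_convergence (fun x => ‖f x‖)
      (fun N => hf.aestronglyMeasurable.indicator (measurableSet_logShell N)) hf.norm
      (fun N => ae_of_all _ fun x => norm_indicator_le_norm_self _ _) (ae_of_all _ fun x => ?_)
    refine tendsto_const_nhds.congr' ?_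
    filter_upwards [eventually_lt_natCast (c := logNorm x)] with N hN
    exact (indicator_of_notMem (fun h => absurd h.1 (not_le.2 hN)) _).symm
  rw [integral_zero] at h
  exact h.congr fun N => integral_indicator (measurableSet_logShell N)

theorem rpow_le_add_rpow_of_two_mul_eq {b r r₁ r₂ c : ℝ} (hb : 0 ≤ b) (hr₁ : 0 ≤ r₁)
    (hr₂ : 0 ≤ r₂) (hr : 2 * r = r₁ + r₂) (hc : 0 < c) :
    b ^ r ≤ c * b ^ r₁ + c⁻¹ * b ^ r₂ := by
  have h1 : (b ^ r) ^ 2 = b ^ r₁ * b ^ r₂ := by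
    rw [← Real.rpow_add_of_nonneg hb hr₁ hr₂, ← hr, mul_comm, Real.rpow_mul hb, Real.rpow_two]
  have hX : 0 ≤ b ^ r₁ := by positivity
  have hY : 0 ≤ b ^ r₂ := by positivity
  refine le_trans (le_abs_self _) (abs_le_of_sq_le_sq ?_ (by positivity))
  rw [h1]
  have h2 : (c * b ^ r₁) * (c⁻¹ * b ^ r₂) = b ^ r₁ * b ^ r₂ := by field_simp
  nlinarith [sq_nonneg (c * b ^ r₁), sq_nonneg (c⁻¹ * b ^ r₂), mul_nonneg hX hY]

theorem setIntegral_logShell_le (hVloc : LocallyIntegrable V volume)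
    (hVpos : ∀ᵐ x : Em m, 0 < V x) (hu : Continuous u) {a s t c : ℝ} {l N : ℕ}
    (hl : l ≠ 0) (hN : 0 < N) (ha : 0 < a) (ht : 0 < a - s * (t / N))
    (ht' : 0 < a - s * (4 * t / (2 * N : ℕ)))
    (hc : 0 < c) (hint : Integrable fun x => V x * |u x| ^ a) :
    ∫ x in logShell m N, V x * |u x| ^ (a - s * (t / N)) * logCutoff N x ^ l ≤
      c * (∫ x, V x * |u x| ^ (a - s * (4 * t / (2 * N : ℕ))) * logCutoff (2 * N) x ^ l) +
        c⁻¹ * ∫ x in logShell m N, V x * |u x| ^ a := by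
  have hN' : (0 : ℝ) < N := by exact_mod_cast hN
  have hS := measurableSet_logShell (m := m) N
  have hf := integrable_potential_mul (r := a - s * (t / N)) hVloc hu
    (contDiff_logCutoff N).continuous (hasCompactSupport_logCutoff hN) ht.le hl
  have hg := integrable_potential_mul (r := a - s * (4 * t / (2 * N : ℕ))) hVloc hu
    (contDiff_logCutoff (2 * N)).continuous (hasCompactSupport_logCutoff (by omega)) ht'.le hl
  have hle : ∫ x in logShell m N, V x * |u x| ^ (a - s * (4 * t / (2 * N : ℕ))) *
      logCutoff (2 * N) x ^ l ≤
      ∫ x, V x * |u x| ^ (a - s * (4 * t / (2 * N : ℕ))) * logCutoff (2 * N) x ^ l :=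
    setIntegral_le_integral hg (by
      filter_upwards [hVpos] with x hx
      have := logCutoff_nonneg (2 * N) x
      simp only [Pi.zero_apply]
      positivity)
  refine le_trans ?_ (add_le_add_left (mul_le_mul_of_nonneg_left hle hc.le) _)
  rw [← integral_const_mul, ← integral_const_mul,
    ← integral_add (hg.integrableOn.const_mul _) (hint.integrableOn.const_mul _)]
  refine setIntegral_mono_ae_restrict hf.integrableOn
    ((hg.integrableOn.const_mul _).add (hint.integrableOn.const_mul _)) ?_
  filter_upwards [ae_restrict_of_ae hVpos, ae_restrict_mem hS] with x hx hxS
  rw [logCutoff_eq_one (N := 2 * N) (by omega) (by push_cast; exact hxS.2), one_pow, mul_one]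
  have h1 : logCutoff N x ^ l ≤ 1 := pow_le_one₀ (logCutoff_nonneg N x) (logCutoff_le_one N x)
  have h2 := rpow_le_add_rpow_of_two_mul_eq (abs_nonneg (u x)) ht'.le ha.le
    (show 2 * (a - s * (t / N)) = a - s * (4 * t / (2 * N : ℕ)) + a by
      push_cast; field_simp; ring) hc
  calc V x * |u x| ^ (a - s * (t / N)) * logCutoff N x ^ l
      ≤ V x * |u x| ^ (a - s * (t / N)) * 1 := by gcongr
    _ ≤ V x * (c * |u x| ^ (a - s * (4 * t / (2 * N : ℕ))) + c⁻¹ * |u x| ^ a) := by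
        rw [mul_one]; gcongr
    _ = _ := by ring

theorem lintegral_potential_eq_zero (hp : 2 ≤ p) (hσ : p - 1 < σ)
    (hVloc : LocallyIntegrable V volume) (hVpos : ∀ᵐ x : Em m, 0 < V x) (hHP : HP1 p σ V)
    (hu : IsWeakSol p σ V u) (hst : IsStable p σ V u) :
    ∫⁻ x, ENNReal.ofReal (V x * |u x| ^ (σ + gammaBar p σ)) = 0 := by
  have hβ := betaC_pos hp hσ
  have ha : 0 < σ + gammaBar p σ := by linarith [one_lt_gammaBar hp hσ]
  have hcu := hu.1.continuous
  obtain ⟨k, hk⟩ : ∃ k : ℕ, alphaC p σ < 2 * k + 2 := by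
    obtain ⟨k, hk⟩ := exists_nat_gt (alphaC p σ)
    exact ⟨k, by linarith [k.cast_nonneg (α := ℝ)]⟩
  obtain ⟨M, -, hM⟩ := exists_integral_cutoff_bounded hp hσ hVloc hVpos hHP hu hst hk one_pos
  obtain ⟨M', hM'0, hM'⟩ := exists_integral_cutoff_bounded hp hσ hVloc hVpos hHP hu hst hk
    (show (0 : ℝ) < 4 * 1 by norm_num)
  obtain ⟨K, hK, hkey⟩ := exists_integral_cutoff_le hp hσ hVloc hVpos hHP hu hst hk one_pos
  have hl : 2 * k + 2 ≠ 0 := by omega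
  have hdouble : Tendsto (fun N : ℕ => 2 * N) atTop atTop :=
    tendsto_id.const_mul_atTop' two_pos
  have hint : Integrable fun x => V x * |u x| ^ (σ + gammaBar p σ) := by
    refine (integrable_and_integral_le_of_lintegral_le (le_max_right M 0) ?_ ?_
      ((lintegral_potential_le hVloc hVpos hcu ha hl hM).trans
        (ENNReal.ofReal_le_ofReal (le_max_left _ _)))).1
    · exact (hVloc.aestronglyMeasurable.mul
        (hcu.abs.rpow_const fun _ => Or.inr ha.le).aestronglyMeasurable)
    · filter_upwards [hVpos] with x hx
      simp only [Pi.zero_apply]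
      positivity
  have hshell : ∀ δ : ℝ, 0 < δ → ∀ᶠ N : ℕ in atTop, ∫ x in logShell m N,
      V x * |u x| ^ (σ + gammaBar p σ - (σ - p + 1) * (1 / N)) *
        logCutoff N x ^ (2 * k + 2) ≤ δ := by
    intro δ hδ
    obtain ⟨c, hc⟩ : ∃ c : ℝ, c = δ / (2 * M') := ⟨_, rfl⟩
    have hc0 : 0 < c := by rw [hc]; positivity
    filter_upwards [hdouble.eventually hM', eventually_gt_atTop 0,
      (tendsto_sub_mul_div_natCast (σ + gammaBar p σ) (σ - p + 1) 1).eventually_const_lt ha,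
      hdouble.eventually ((tendsto_sub_mul_div_natCast (σ + gammaBar p σ) (σ - p + 1)
        (4 * 1)).eventually_const_lt ha),
      (tendsto_setIntegral_logShell hint).eventually_lt_const (show 0 < c * (δ / 2) by positivity)]
      with N h1 hN h2 h3 h4
    refine (setIntegral_logShell_le hVloc hVpos hcu hl hN ha h2 h3 hc0 hint).trans ?_
    have h5 := mul_le_mul_of_nonneg_left h1 hc0.le
    have h6 := mul_le_mul_of_nonneg_left h4.le (inv_nonneg.2 hc0.le)
    rw [inv_mul_cancel_left₀ hc0.ne'] at h6
    have h7 : c * M' = δ / 2 := by rw [hc]; field_simp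
    linarith
  have hsmall : ∀ δ : ℝ, 0 < δ → ∀ᶠ N : ℕ in atTop,
      ∫ x, V x * |u x| ^ (σ + gammaBar p σ - (σ - p + 1) * (1 / N)) *
        logCutoff N x ^ (2 * k + 2) ≤ δ := by
    intro δ hδ
    have hμ : Tendsto (fun μ : ℝ => K * μ ^ (-(betaC p σ / 2))) atTop (nhds (K * 0)) :=
      (tendsto_rpow_neg_atTop (half_pos hβ)).const_mul K
    rw [mul_zero] at hμ
    obtain ⟨μ, hμδ, hμ1⟩ := ((hμ.eventually_lt_const (half_pos hδ)).and
      (eventually_ge_atTop 1)).exists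
    have hμ0 : 0 < μ := by linarith
    filter_upwards [hkey, hshell (δ / 2 / μ) (by positivity),
      (tendsto_const_div_atTop_nhds_zero_nat 1).eventually_lt_const (half_pos hβ)] with N h1 h2 h3
    refine (h1 μ hμ0).trans ?_
    rw [le_div_iff₀ hμ0] at h2
    have h4 : μ ^ (-(betaC p σ - 1 / N)) ≤ μ ^ (-(betaC p σ / 2)) :=
      Real.rpow_le_rpow_of_exponent_le hμ1 (by linarith)
    have h5 := mul_le_mul_of_nonneg_left h4 hK.le
    linarith
  refine le_antisymm (ENNReal.le_of_forall_pos_le_add fun δ hδ _ => ?_) zero_le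
  rw [zero_add, ← ENNReal.ofReal_coe_nnreal]
  exact lintegral_potential_le hVloc hVpos hcu ha hl (hsmall δ (by exact_mod_cast hδ))

end Vanishing

theorem nonexistence_stable_HP1 (m : ℕ) (hm : 1 ≤ m) (p σ : ℝ) (hp : 2 ≤ p) (hσ : p - 1 < σ)
    (V : Em m → ℝ) (hVloc : LocallyIntegrable V volume)
    (hVpos : ∀ᵐ x : Em m, 0 < V x)
    (hHP1 : HP1 p σ V)
    (u : Em m → ℝ) (hu : IsWeakSol p σ V u) (hst : IsStable p σ V u) :
    ∀ᵐ x : Em m, u x = 0 := by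
  have hzero := lintegral_potential_eq_zero hp hσ hVloc hVpos hHP1 hu hst
  have ha : 0 < σ + gammaBar p σ := by linarith [one_lt_gammaBar hp hσ]
  rw [lintegral_eq_zero_iff'] at hzero
  · filter_upwards [hzero, hVpos] with x hx hVx
    by_contra hux
    have : 0 < V x * |u x| ^ (σ + gammaBar p σ) :=
      mul_pos hVx (Real.rpow_pos_of_pos (abs_pos.2 hux) _)
    exact (ENNReal.ofReal_pos.2 this).ne' hx
  · exact (hVloc.aestronglyMeasurable.mul (hu.1.continuous.abs.rpow_const fun _ =>
      Or.inr ha.le).aestronglyMeasurable).aemeasurable.ennreal_ofReal
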